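/- arXiv:math/0612458 — 12 statements merged into one kernel-verified Lean document; each statement's English description precedes it below -/
import Mathlib

section
/- If E is an infinite set, then the poset 𝒫(E)/Fin does not have the chain-gap property. -/
universe u
def IsPregap {P : Type u} [Preorder P] (A B : Set P) : Prop :=
  ∀ a ∈ A, ∀ b ∈ B, a ≤ b

def IsGap {P : Type u} [Preorder P] (A B : Set P) : Prop :=
  IsPregap A B ∧ ¬ ∃ x : P, (∀ a ∈ A, a ≤ x) ∧ (∀ b ∈ B, x ≤ b)

def ChainGapProperty (P : Type u) [Preorder P] : Prop :=
  ∀ A B : Set P, IsGap A B →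
    ∃ (C : Type u) (lo : LinearOrder C) (g : P → C),
      @Monotone P C _ lo.toPreorder g ∧ @IsGap C lo.toPreorder (g '' A) (g '' B)

/-- `𝒫(E)` as a carrier for the `≤_Fin` quasiorder. -/
def PFin (E : Type u) : Type u := Set E

/-- The underlying set of an element of `PFin E`. -/
def PFin.toSet {E : Type u} (X : PFin E) : Set E := X

/-- The quasiorder `X ≤_Fin Y` iff `X \ Y` is finite. -/
instance (E : Type u) : Preorder (PFin E) where
  le X Y := (X.toSet \ Y.toSet).Finite
  le_refl X := by simp
  le_trans X Y Z h1 h2 := Set.Finite.subset (h1.union h2) (by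
    intro x hx
    by_cases h : x ∈ Y.toSet <;> simp only [Set.mem_diff, Set.mem_union] at hx ⊢ <;> tauto)

/-- `𝒫(E)/Fin`, the partially ordered quotient of the quasiorder `≤_Fin`. -/
def PFinQuot (E : Type u) : Type u := Antisymmetrization (PFin E) (· ≤ ·)

instance (E : Type u) : PartialOrder (PFinQuot E) :=
  inferInstanceAs (PartialOrder (Antisymmetrization (PFin E) (· ≤ ·)))


/-- The class of a set in the quotient. -/
def pfMk {E : Type u} (X : Set E) : PFinQuot E :=
  toAntisymmetrization (α := PFin E) (· ≤ ·) X

theorem pfMk_le {E : Type u} (X Y : Set E) : pfMk X ≤ pfMk Y ↔ (X \ Y).Finite := Iff.rfl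

theorem pfMk_surj {E : Type u} (x : PFinQuot E) : ∃ X : Set E, pfMk X = x :=
  Quotient.exists_rep x

/-- An almost disjoint family of sets of naturals indexed by functions. -/
def adSet (φ : ℕ → ℕ) : Set ℕ := Set.range fun n => Encodable.encode ((List.range n).map φ)

theorem adSet_inj (φ ψ : ℕ → ℕ) (n m : ℕ)
    (h : Encodable.encode ((List.range n).map φ) = Encodable.encode ((List.range m).map ψ)) :
    n = m ∧ ∀ k < n, φ k = ψ k := by
  have h1 := Encodable.encode_injective h
  have h2 : n = m := by simpa using congrArg List.length h1
  subst h2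
  refine ⟨rfl, fun k hk => ?_⟩
  rw [List.map_inj_left] at h1
  exact h1 k (List.mem_range.2 hk)

theorem adSet_infinite (φ : ℕ → ℕ) : (adSet φ).Infinite :=
  Set.infinite_range_of_injective fun n m h => (adSet_inj φ φ n m h).1

theorem adSet_inter (φ ψ : ℕ → ℕ) (h : φ ≠ ψ) : (adSet φ ∩ adSet ψ).Finite := by
  obtain ⟨m, hm⟩ := Function.ne_iff.1 h
  refine ((Set.finite_Iic m).image
    (fun n => Encodable.encode ((List.range n).map φ))).subset ?_
  rintro _ ⟨⟨n, rfl⟩, ⟨n', hn'⟩⟩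
  refine ⟨n, ?_, rfl⟩
  by_contra hc
  exact hm ((adSet_inj φ ψ n n' hn'.symm).2 m (by simpa using hc))

theorem exists_records {C : Type*} [LinearOrder C] (c : ℕ → C) (hc : ∀ n, ∃ m, c n < c m) :
    {m | ∀ k < m, c k < c m}.Infinite := by
  rw [Set.infinite_iff_exists_gt]
  intro N
  have hex : ∃ m, ∀ k ≤ N, c k < c m := by
    obtain ⟨k0, -, hk0⟩ := Finset.exists_max_image (Finset.range (N+1)) c ⟨0, by simp⟩
    obtain ⟨m, hm⟩ := hc k0
    exact ⟨m, fun k hk => (hk0 k (by simp; omega)).trans_lt hm⟩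
  classical
  have hs := Nat.find_spec hex
  refine ⟨Nat.find hex, fun k hk => ?_, ?_⟩
  · have := Nat.find_min hex hk
    push Not at this
    obtain ⟨k', h1, h2⟩ := this
    exact h2.trans_lt (hs k' h1)
  · by_contra hlt
    exact lt_irrefl _ (hs _ (not_lt.1 hlt))

theorem powFin_not_chainGap (E : Type u) [Infinite E] :
    ¬ ChainGapProperty (PFinQuot E) := by
  intro hP
  obtain ⟨e⟩ : Nonempty (ℕ × ℕ ↪ E) :=
    ⟨(Denumerable.eqv (ℕ × ℕ)).toEmbedding.trans (Infinite.natEmbedding E)⟩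
  let col : ℕ → Set E := fun n => e '' {p | p.1 = n}
  let gr : (ℕ → ℕ) → Set E := fun φ => e '' {p | p.1 ∈ adSet φ ∧ p.2 ≤ φ p.1}
  have fin1 : ∀ (φ : ℕ → ℕ) (Y : Set ℕ), (Y ∩ adSet φ).Finite →
      ((e '' {p | p.1 ∈ Y}) \ (gr φ)ᶜ).Finite := by
    intro φ Y hY
    refine ((hY.biUnion fun n _ => (Set.finite_Iic (φ n)).image fun k => e (n, k))).subset ?_
    rintro _ ⟨⟨⟨n, k⟩, hn, rfl⟩, h2⟩
    rw [Set.mem_compl_iff, not_not] at h2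
    obtain ⟨p, hp, hpe⟩ := h2
    have := e.injective hpe
    subst this
    simp only [Set.mem_iUnion]
    exact ⟨n, ⟨hn, hp.1⟩, k, hp.2, rfl⟩
  have hgap : IsGap (Set.range fun n => pfMk (col n)) (Set.range fun φ => pfMk (gr φ)ᶜ) := by
    constructor
    · rintro _ ⟨n, rfl⟩ _ ⟨φ, rfl⟩
      exact (pfMk_le _ _).2 (fin1 φ {n} ((Set.finite_singleton n).subset Set.inter_subset_left))
    · rintro ⟨x, hA, hB⟩
      obtain ⟨S, rfl⟩ := pfMk_surj x
      have h1 : ∀ n, ∃ k, e (n, k) ∈ S := by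
        intro n
        by_contra hc
        push Not at hc
        have := (pfMk_le _ _).1 (hA _ ⟨n, rfl⟩)
        refine Set.infinite_of_injective_forall_mem (f := fun k : ℕ => e (n, k)) ?_ ?_ this
        · intro a b hab
          simpa using e.injective hab
        · exact fun k => ⟨⟨(n, k), rfl, rfl⟩, hc k⟩
      choose φ hφ using h1
      have h2 := (pfMk_le _ _).1 (hB _ ⟨φ, rfl⟩)
      have h3 : ((fun n => e (n, φ n)) '' adSet φ).Infinite :=
        (adSet_infinite φ).image (fun a _ b _ hab => congrArg Prod.fst (e.injective hab))
      refine h3 (h2.subset ?_)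
      rintro _ ⟨n, hn, rfl⟩
      exact ⟨hφ n, fun hc => hc ⟨(n, φ n), ⟨hn, le_rfl⟩, rfl⟩⟩
  obtain ⟨C, lo, g, hg, hpre, hsep⟩ := hP _ _ hgap
  let c : ℕ → C := fun n => g (pfMk (col n))
  have hAB : ∀ n φ, c n ≤ g (pfMk (gr φ)ᶜ) := fun n φ => 
    hpre _ ⟨_, ⟨n, rfl⟩, rfl⟩ _ ⟨_, ⟨φ, rfl⟩, rfl⟩
  have hs : ∀ x : C, (∀ n, c n ≤ x) → (∀ φ, x ≤ g (pfMk (gr φ)ᶜ)) → False := by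
    intro x h1 h2
    refine hsep ⟨x, ?_, ?_⟩
    · rintro _ ⟨_, ⟨n, rfl⟩, rfl⟩
      exact h1 n
    · rintro _ ⟨_, ⟨φ, rfl⟩, rfl⟩
      exact h2 φ
  have hc : ∀ n, ∃ m, c n < c m := by
    intro n
    by_contra h
    push Not at h
    exact hs (c n) h (hAB n)
  have hY := exists_records c hc
  set Y := {m | ∀ k < m, c k < c m} with hYdef
  obtain ⟨Z, φ0, hZY, hZ, hZφ⟩ : ∃ (Z : Set ℕ) (φ0 : ℕ → ℕ), Z ⊆ Y ∧ Z.Infinite ∧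
      ∀ φ, φ ≠ φ0 → (Z ∩ adSet φ).Finite := by
    by_cases h : ∃ φ, (Y ∩ adSet φ).Infinite
    · obtain ⟨φ0, h0⟩ := h
      refine ⟨Y ∩ adSet φ0, φ0, Set.inter_subset_left, h0, fun φ hφ => ?_⟩
      exact (adSet_inter φ φ0 hφ).subset fun x hx => ⟨hx.2, hx.1.2⟩
    · push Not at h
      exact ⟨Y, 0, subset_rfl, hY, fun φ _ => by simpa using h φ⟩
  let s : C := g (pfMk (e '' {p | p.1 ∈ Z}))
  have hsA : ∀ n, c n ≤ s := by
    intro n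
    obtain ⟨m, hm, hnm⟩ := hZ.exists_gt n
    refine (hZY hm n hnm).le.trans (hg ((pfMk_le _ _).2 ?_))
    convert Set.finite_empty
    rw [Set.diff_eq_empty]
    refine Set.image_mono ?_
    intro p hp
    have hp' : p.1 = m := hp
    show p.1 ∈ Z
    rw [hp']; exact hm
  have hsB : ∀ φ, φ ≠ φ0 → s ≤ g (pfMk (gr φ)ᶜ) := fun φ hφ =>
    hg ((pfMk_le _ _).2 (fin1 φ Z (hZφ φ hφ)))
  rcases le_total s (g (pfMk (gr φ0)ᶜ)) with h | h
  · refine hs s hsA fun φ => ?_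
    by_cases hφ : φ = φ0
    · rw [hφ]; exact h
    · exact hsB φ hφ
  · refine hs _ (fun n => hAB n φ0) fun φ => ?_
    by_cases hφ : φ = φ0
    · rw [hφ]
    · exact h.trans (hsB φ hφ)
end

section
/- The lattice L(S,≤) has the chain-gap property. -/
universe u

/-- The reflexive closure `x ≤_{ω₁} y` of the well-ordering `w` of `S`. -/
def leW {S : Set ℝ} (w : S → S → Prop) (x y : S) : Prop := w x y ∨ x = y

/-- The Sierpinskization order on `S`: `x ≤ y` iff `x ≤_{ω₁} y` and `x ≤_ℝ y`. -/
def poS {S : Set ℝ} (w : S → S → Prop) (x y : S) : Prop :=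
  leW w x y ∧ (x : ℝ) ≤ (y : ℝ)

/-- The principal initial segment `↓x` of the Sierpinskization `(S, ≤)`. -/
def dseg {S : Set ℝ} (w : S → S → Prop) (x : S) : Set S := {y | poS w y x}

/-- Membership in `L(S,≤)`: finite unions of finite intersections of principal
initial segments of `(S, ≤)`. -/
def Lmem {S : Set ℝ} (w : S → S → Prop) (X : Set S) : Prop :=
  ∃ F : Finset (Finset S), F.Nonempty ∧ (∀ G ∈ F, G.Nonempty) ∧
    X = ⋃ G ∈ F, ⋂ x ∈ G, dseg w x

/-- The lattice `L(S,≤)`, ordered by inclusion. -/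
abbrev LS (S : Set ℝ) (w : S → S → Prop) : Type := {X : Set S // Lmem w X}

/-- The hypotheses on `S` and the well-ordering `w`: `S ⊆ ℝ` is `ℵ₁`-dense of
cardinality `ℵ₁`, has no greatest or least element, and `w` has order type `ω₁`. -/
def SierpCond (S : Set ℝ) (w : S → S → Prop) [IsWellOrder S w] : Prop :=
  Cardinal.mk ↥S = Cardinal.aleph 1 ∧
  (∀ a b : S, (a : ℝ) < (b : ℝ) →
    Cardinal.aleph 1 ≤ Cardinal.mk ↥{x : S | (a : ℝ) < (x : ℝ) ∧ (x : ℝ) < (b : ℝ)}) ∧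
  (∀ a : S, ∃ b : S, (a : ℝ) < (b : ℝ)) ∧
  (∀ a : S, ∃ b : S, (b : ℝ) < (a : ℝ)) ∧
  Ordinal.type w = (Cardinal.aleph 1).ord

section helpers

theorem chain_of_upsets {P : Type} [Preorder P] (A B : Set P) (hpre : IsPregap A B)
    (T : Set (Set P)) (hT : ∀ U ∈ T, ∀ V ∈ T, U ⊆ V ∨ V ⊆ U)
    (hup : ∀ U ∈ T, ∀ x y : P, x ≤ y → x ∈ U → y ∈ U)
    (hsep : ∀ x : P, (∃ U ∈ T, x ∉ U ∧ ∃ a ∈ A, a ∈ U) ∨ (∃ U ∈ T, x ∈ U ∧ ∃ b ∈ B, b ∉ U)) :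
    ∃ (C : Type) (lo : LinearOrder C) (g : P → C),
      @Monotone P C _ lo.toPreorder g ∧ @IsGap C lo.toPreorder (g '' A) (g '' B) := by
  classical
  let g0 : P → Set (Set P) := fun x => {U | U ∈ T ∧ x ∈ U}
  have hm : ∀ x y, x ≤ y → g0 x ⊆ g0 y := fun x y hxy U hU => ⟨hU.1, hup U hU.1 x y hxy hU.2⟩
  let C := {s : Set (Set P) // ∃ x, s = g0 x}
  have htot : ∀ a b : C, a ≤ b ∨ b ≤ a := by
    rintro ⟨_, x, rfl⟩ ⟨_, y, rfl⟩
    by_contra hcon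
    push Not at hcon
    obtain ⟨h1, h2⟩ := hcon
    have h1 : ¬ g0 x ⊆ g0 y := h1
    have h2 : ¬ g0 y ⊆ g0 x := h2
    rw [Set.not_subset] at h1 h2
    obtain ⟨U, ⟨hU, hxU⟩, hyU⟩ := h1
    obtain ⟨V, ⟨hV, hyV⟩, hxV⟩ := h2
    rcases hT U hU V hV with h | h
    · exact hxV ⟨hV, h hxU⟩
    · exact hyU ⟨hU, h hyV⟩
  let lo : LinearOrder C :=
    { (inferInstance : PartialOrder C) with
      le_total := htot
      toDecidableLE := Classical.decRel _ }
  refine ⟨C, lo, fun x => ⟨g0 x, x, rfl⟩, fun x y hxy => hm x y hxy, ?_, ?_⟩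
  · rintro _ ⟨a, ha, rfl⟩ _ ⟨b, hb, rfl⟩
    exact hm a b (hpre a ha b hb)
  · rintro ⟨⟨_, x, rfl⟩, h1, h2⟩
    rcases hsep x with ⟨U, hU, hxU, a, ha, haU⟩ | ⟨U, hU, hxU, b, hb, hbU⟩
    · have : g0 a ⊆ g0 x := h1 _ ⟨a, ha, rfl⟩
      exact hxU (this ⟨hU, haU⟩).2
    · have : g0 x ⊆ g0 b := h2 _ ⟨b, hb, rfl⟩
      exact hbU (this ⟨hU, hxU⟩).2

theorem countable_cofinal_real {S : Set ℝ} (Q : Set S) :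
    ∃ Q0 : Set S, Q0.Countable ∧ Q0 ⊆ Q ∧ ∀ s ∈ Q, ∃ q ∈ Q0, (s : ℝ) ≤ q := by
  classical
  by_cases hmax : ∃ m ∈ Q, ∀ s ∈ Q, (s : ℝ) ≤ m
  · obtain ⟨m, hm, h⟩ := hmax
    exact ⟨{m}, Set.countable_singleton m, by simpa using hm, fun s hs => ⟨m, rfl, h s hs⟩⟩
  · push Not at hmax
    have : ∀ p : {p : ℚ // ∃ t ∈ Q, (p : ℝ) < (t : ℝ)}, ∃ t ∈ Q, ((p : ℚ) : ℝ) < (t : ℝ) :=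
      fun p => p.2
    choose f hf hf' using this
    refine ⟨Set.range f, Set.countable_range f, ?_, ?_⟩
    · rintro _ ⟨p, rfl⟩; exact hf p
    · intro s hs
      obtain ⟨t, ht, hst⟩ := hmax s hs
      obtain ⟨p, h1, h2⟩ := exists_rat_btwn hst
      exact ⟨f ⟨p, t, ht, h2⟩, ⟨_, rfl⟩, (h1.trans (hf' ⟨p, t, ht, h2⟩)).le⟩

theorem seq_of_finite_sat {ι α : Type} [Countable ι] (p : ι → α → Prop) (R : α → Prop)
    (h : ∀ t : Finset ι, ∃ z, R z ∧ ∀ i ∈ t, p i z) :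
    ∃ z : ℕ → α, (∀ n, R (z n)) ∧ ∀ i, ∃ N, ∀ n, N ≤ n → p i (z n) := by
  classical
  obtain ⟨e, he⟩ := exists_injective_nat ι
  have hfin : ∀ n : ℕ, {i | e i < n}.Finite := fun n =>
    Set.Finite.preimage he.injOn (Set.finite_Iio n)
  choose z hz1 hz2 using fun n : ℕ => h (hfin n).toFinset
  refine ⟨z, hz1, fun i => ⟨e i + 1, fun n hn => hz2 n i ?_⟩⟩
  simp; omega

variable {S : Set ℝ} (w : S → S → Prop) [IsWellOrder S w]

theorem leW_or (x y : S) : leW w x y ∨ w y x := by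
  rcases trichotomous_of w x y with h | h | h
  · exact Or.inl (Or.inl h)
  · exact Or.inl (Or.inr h)
  · exact Or.inr h

theorem not_w_of_leW {x y : S} (h : leW w x y) (h' : w y x) : False := by
  rcases h with h | rfl
  · exact irrefl_of w x (trans_of w h h')
  · exact irrefl_of w x h'

theorem leW_trans {x y z : S} (h : leW w x y) (h' : leW w y z) : leW w x z := by
  rcases h with h | rfl
  · rcases h' with h' | rfl
    · exact Or.inl (trans_of w h h')
    · exact Or.inl h
  · exact h'

theorem leW_w {x y z : S} (h : leW w x y) (h' : w y z) : w x z := by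
  rcases h with h | rfl
  · exact trans_of w h h'
  · exact h'

theorem poS_trans {x y z : S} (h : poS w x y) (h' : poS w y z) : poS w x z :=
  ⟨leW_trans w h.1 h'.1, h.2.trans h'.2⟩

theorem Lmem_lower {X : Set S} (hX : Lmem w X) {x y : S} (h : poS w y x) (hx : x ∈ X) : y ∈ X := by
  obtain ⟨F, -, -, rfl⟩ := hX
  simp only [Set.mem_iUnion, Set.mem_iInter] at hx ⊢
  obtain ⟨G, hG, hx⟩ := hx
  exact ⟨G, hG, fun g hg => poS_trans w h (hx g hg)⟩

theorem Lmem_union {X Y : Set S} (hX : Lmem w X) (hY : Lmem w Y) : Lmem w (X ∪ Y) := by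
  classical
  obtain ⟨F, hF, hF', rfl⟩ := hX
  obtain ⟨F2, hF2, hF2', rfl⟩ := hY
  refine ⟨F ∪ F2, hF.mono Finset.subset_union_left, ?_, ?_⟩
  · intro G hG
    rcases Finset.mem_union.1 hG with h | h
    · exact hF' G h
    · exact hF2' G h
  · rw [Finset.set_biUnion_union]

theorem Lmem_inter (x y : S) : Lmem w (dseg w x ∩ dseg w y) := by
  classical
  refine ⟨{{x, y}}, by simp, by simp, ?_⟩
  rw [Finset.set_biUnion_singleton, Finset.set_biInter_insert, Finset.set_biInter_singleton]

theorem Lmem_dseg (x : S) : Lmem w (dseg w x) := by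
  simpa using Lmem_inter w x x

/-- finite subsets of an initial segment are bounded in it -/
theorem finset_bound (K : Set S) (hK : K.Nonempty) (t : Finset S) (ht : ∀ x ∈ t, x ∈ K) :
    ∃ x ∈ K, ∀ y ∈ t, leW w y x := by
  classical
  induction t using Finset.induction_on with
  | empty => obtain ⟨k, hk⟩ := hK; exact ⟨k, hk, by simp⟩
  | insert a t _ ih =>
    obtain ⟨x, hx, h⟩ := ih (fun x hx => ht x (Finset.mem_insert_of_mem hx))
    rcases leW_or w a x with hax | hxa
    · refine ⟨x, hx, fun y hy => ?_⟩
      rcases Finset.mem_insert.1 hy with rfl | hy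
      · exact hax
      · exact h y hy
    · refine ⟨a, ht a (Finset.mem_insert_self _ _), fun y hy => ?_⟩
      rcases Finset.mem_insert.1 hy with rfl | hy
      · exact Or.inr rfl
      · exact leW_trans w (h y hy) (Or.inl hxa)

/-- the diagonal set `Z` -/
theorem exists_Z (I K : Set S) (hK : K.Nonempty) (hKc : K.Countable ∨ K = Set.univ)
    (hcof : ∀ x ∈ K, ∃ z ∈ I ∩ K, w x z) :
    ∃ Z : Set S, Z ⊆ I ∩ K ∧ (∀ x ∈ K, ∃ z ∈ Z, w x z) ∧
      ∀ s, s ∉ K → (∀ x ∈ K, ∃ z ∈ Z, w x z ∧ (z : ℝ) ≤ s) →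
        ∃ x ∈ K, ∀ z ∈ I ∩ K, w x z → (z : ℝ) ≤ s := by
  classical
  rcases hKc with hKc | rfl
  swap
  · exact ⟨I, by simp, by simpa using hcof, fun s hs => absurd (Set.mem_univ s) hs⟩
  obtain ⟨Q0, hQc, hQsub, hQcof⟩ :=
    countable_cofinal_real {s : S | ∀ x ∈ K, ∃ z ∈ I ∩ K, w x z ∧ (s : ℝ) < z}
  have := hKc.to_subtype
  have := hQc.to_subtype
  obtain ⟨z, hz, hz'⟩ := seq_of_finite_sat (ι := K ⊕ Q0) (α := S)
    (fun i z => Sum.elim (fun k : K => w k z) (fun q : Q0 => ((q : S) : ℝ) < z) i)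
    (fun z => z ∈ I ∩ K) (by
      intro t
      obtain ⟨x, hx, hxt⟩ := finset_bound w K hK (t.toLeft.image (Subtype.val : K → S))
        (by intro x hx; obtain ⟨k, -, rfl⟩ := Finset.mem_image.1 hx; exact k.2)
      have : ∃ z ∈ I ∩ K, w x z ∧ ∀ q ∈ t.toRight, ((q : S) : ℝ) < z := by
        by_cases hne : t.toRight.Nonempty
        · obtain ⟨m, hm, hmax⟩ := Finset.exists_max_image t.toRight (fun q => ((q : S) : ℝ)) hne
          obtain ⟨z, hz, hxz, hmz⟩ := hQsub m.2 x hx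
          exact ⟨z, hz, hxz, fun q hq => (hmax q hq).trans_lt hmz⟩
        · obtain ⟨z, hz, hxz⟩ := hcof x hx
          exact ⟨z, hz, hxz, fun q hq => absurd ⟨q, hq⟩ hne⟩
      obtain ⟨z, hz, hxz, hq⟩ := this
      refine ⟨z, hz, ?_⟩
      rintro (k | q) hi
      · exact leW_w w (hxt k (Finset.mem_image.2 ⟨k, by simpa using hi, rfl⟩)) hxz
      · exact hq q (by simpa using hi))
  refine ⟨Set.range z, ?_, ?_, ?_⟩
  · rintro _ ⟨n, rfl⟩; exact hz n
  · intro x hx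
    obtain ⟨N, hN⟩ := hz' (Sum.inl ⟨x, hx⟩)
    exact ⟨z N, ⟨N, rfl⟩, hN N le_rfl⟩
  · intro s hs hfreq
    by_contra hcon
    push Not at hcon
    obtain ⟨q, hq, hsq⟩ := hQcof s hcon
    obtain ⟨N, hN⟩ := hz' (Sum.inr ⟨q, hq⟩)
    obtain ⟨x, hx, hxb⟩ := finset_bound w K hK ((Finset.range N).image z)
      (by simp only [Finset.mem_image]; rintro _ ⟨k, -, rfl⟩; exact (hz k).2)
    obtain ⟨_, ⟨n, rfl⟩, hxn, hns⟩ := hfreq x hx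
    by_cases hn : N ≤ n
    · have : (q : ℝ) < z n := hN n hn
      linarith
    · exact not_w_of_leW w (hxb (z n) (Finset.mem_image.2 ⟨n, by simpa using hn, rfl⟩)) hxn

theorem countable_below (htype : Ordinal.type w = (Cardinal.aleph 1).ord) (k : S) :
    {x | w x k}.Countable := by
  have h1 : Ordinal.typein w k < (Cardinal.aleph 1).ord := htype ▸ Ordinal.typein_lt_type w k
  rw [Cardinal.lt_ord] at h1
  have h2 : (Ordinal.typein w k).card = Cardinal.mk {x | w x k} := by
    exact Ordinal.card_typein k
  rw [h2, ← Cardinal.succ_aleph0, Order.lt_succ_iff] at h1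
  exact Cardinal.le_aleph0_iff_set_countable.1 h1

end helpers

theorem LS_chainGapProperty (S : Set ℝ) (w : S → S → Prop) [IsWellOrder S w]
    (h : SierpCond S w) : ChainGapProperty (LS S w) := by
  classical
  obtain ⟨-, -, -, hbot, htype⟩ := h
  intro A B hgap
  obtain ⟨hpre, hns⟩ := hgap
  have hwf : WellFounded w := IsWellFounded.wf
  have hne : Nonempty S := by
    by_contra hcon
    rw [not_nonempty_iff] at hcon
    have h0 := Ordinal.type_eq_zero_of_empty w
    rw [htype] at h0
    simp at h0
    exact absurd h0 (Ordinal.omega_pos 1).ne'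
  have hempty : Lmem w (∅ : Set S) := by
    obtain ⟨e, -, he⟩ := hwf.has_min Set.univ Set.univ_nonempty
    obtain ⟨y, hy⟩ := hbot e
    convert Lmem_inter w e y
    symm
    rw [Set.eq_empty_iff_forall_notMem]
    rintro z ⟨h1, h2⟩
    rcases h1.1 with h | rfl
    · exact he z trivial h
    · exact absurd h2.2 (not_le.2 hy)
  let I : Set S := {z | ∃ a ∈ A, z ∈ a.1}
  let Cov : Set S → Prop := fun Y => ∃ X : LS S w, (∀ b ∈ B, X ≤ b) ∧ Y ⊆ X.1
  have hCovU : ∀ Y Y', Cov Y → Cov Y' → Cov (Y ∪ Y') := by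
    rintro Y Y' ⟨X, h1, h2⟩ ⟨X', h1', h2'⟩
    exact ⟨⟨X.1 ∪ X'.1, Lmem_union w X.2 X'.2⟩, fun b hb => Set.union_subset (h1 b hb) (h1' b hb),
      Set.union_subset_union h2 h2'⟩
  have hCovM : ∀ Y Y', Y ⊆ Y' → Cov Y' → Cov Y := by
    rintro Y Y' hY ⟨X, h1, h2⟩
    exact ⟨X, h1, hY.trans h2⟩
  have hCov1 : ∀ x ∈ I, Cov {x} := by
    rintro x ⟨a, ha, hx⟩
    refine ⟨⟨dseg w x, Lmem_dseg w x⟩, fun b hb z hz => hpre a ha b hb (Lmem_lower w a.2 hz hx), ?_⟩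
    rintro _ rfl
    exact ⟨Or.inr rfl, le_rfl⟩
  have hCov0 : Cov ∅ := ⟨⟨∅, hempty⟩, fun b _ => Set.empty_subset _, le_rfl⟩
  have hCovI : ¬ Cov I := by
    rintro ⟨X, h1, h2⟩
    exact hns ⟨X, fun a ha z hz => h2 ⟨a, ha, hz⟩, h1⟩
  let K : Set S := {x | Cov (I ∩ {z | leW w z x})}
  have hKdown : ∀ x y, leW w y x → x ∈ K → y ∈ K := fun x y hyx hx =>
    hCovM _ _ (fun z hz => And.intro hz.1 (leW_trans w hz.2 hyx)) hx
  have hIK : ¬ Cov (I ∩ K) := by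
    intro hc
    by_cases hKu : K = Set.univ
    · exact hCovI (by simpa [hKu] using hc)
    obtain ⟨k, hk, hmin⟩ := hwf.has_min Kᶜ (Set.nonempty_compl.2 hKu)
    apply hk
    by_cases hkI : k ∈ I
    · refine hCovM _ _ ?_ (hCovU _ _ hc (hCov1 k hkI))
      rintro z ⟨hz, h | rfl⟩
      · exact Or.inl ⟨hz, by_contra fun hzK => hmin z hzK h⟩
      · exact Or.inr rfl
    · refine hCovM _ _ ?_ hc
      rintro z ⟨hz, h | rfl⟩
      · exact ⟨hz, by_contra fun hzK => hmin z hzK h⟩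
      · exact absurd hz hkI
  have hKne : K.Nonempty := by
    by_contra hcon
    rw [Set.not_nonempty_iff_eq_empty] at hcon
    exact hIK (by rw [hcon, Set.inter_empty]; exact hCov0)
  have hKlt : ∀ x ∈ K, ∀ y, y ∉ K → w x y := by
    intro x hx y hy
    rcases leW_or w y x with h | h
    · exact absurd (hKdown x y h hx) hy
    · exact h
  have hKc : K.Countable ∨ K = Set.univ := by
    by_cases hKu : K = Set.univ
    · exact Or.inr hKu
    obtain ⟨k, hk⟩ := Set.nonempty_compl.2 hKu
    exact Or.inl ((countable_below w htype k).mono fun x hx => hKlt x hx k hk)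
  have hcof : ∀ x ∈ K, ∃ z ∈ I ∩ K, w x z := by
    intro x hx
    by_contra hcon
    push Not at hcon
    refine hIK (hCovM _ _ ?_ hx)
    intro z hz
    exact ⟨hz.1, (leW_or w z x).resolve_right (hcon z hz)⟩
  obtain ⟨Z, hZ1, hZ2, hZ3⟩ := exists_Z w I K hKne hKc hcof
  -- the element δ(s)
  have hδ : ∀ s : S, ∃ d : S, s ∉ K → d ∉ K ∧ (s : ℝ) ≤ d ∧
      ∀ e, e ∉ K → (s : ℝ) ≤ e → leW w d e := by
    intro s
    by_cases hs : s ∈ K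
    · exact ⟨s, fun h => absurd hs h⟩
    obtain ⟨d, hd, hmin⟩ := hwf.has_min {e | e ∉ K ∧ (s : ℝ) ≤ e} ⟨s, hs, le_rfl⟩
    exact ⟨d, fun _ => ⟨hd.1, hd.2, fun e he hse =>
      (leW_or w d e).resolve_right (hmin e ⟨he, hse⟩)⟩⟩
  choose d hd using hδ
  let R : S → Set S := fun s => dseg w (d s) ∩ dseg w s
  let V : Set S := {s | s ∉ K ∧ ∃ x ∈ K, ∀ z ∈ I ∩ K, w x z → (z : ℝ) ≤ s}
  have hRmono : ∀ s ∈ V, ∀ s' ∈ V, (s' : ℝ) ≤ s → R s' ⊆ R s := by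
    intro s hs s' hs' hle z hz
    obtain ⟨hd1, hd2, hd3⟩ := hd s hs.1
    obtain ⟨hd1', hd2', hd3'⟩ := hd s' hs'.1
    have hzs : (z : ℝ) ≤ s := hz.2.2.trans hle
    exact ⟨⟨leW_trans w hz.1.1 (hd3' _ hd1 (hle.trans hd2)), hzs.trans hd2⟩,
      leW_trans w hz.1.1 (hd3' _ hs.1 hle), hzs⟩
  have hRB : ∀ s ∈ V, ∃ b ∈ B, ¬ R s ⊆ b.1 := by
    rintro s ⟨hs, x, hx, hxs⟩
    by_contra hcon
    push Not at hcon
    obtain ⟨hd1, hd2, hd3⟩ := hd s hs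
    have hc : Cov (R s) := ⟨⟨R s, Lmem_inter w _ _⟩, hcon, le_rfl⟩
    refine hIK (hCovM _ _ ?_ (hCovU _ _ hc hx))
    intro z hz
    rcases leW_or w z x with h | h
    · exact Or.inr ⟨hz.1, h⟩
    · have hzs := hxs z hz h
      exact Or.inl ⟨⟨Or.inl (hKlt z hz.2 _ hd1), hzs.trans hd2⟩, Or.inl (hKlt z hz.2 _ hs), hzs⟩
  let U : Set (LS S w) := {X | ∃ s ∈ V, R s ⊆ X.1}
  let U2 : S → Set (LS S w) := fun s => {X | R s ⊆ X.1}
  let U1 : S → Set (LS S w) := fun x =>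
    U ∪ {X | ∃ a ∈ A, a ≤ X ∧ ∃ z ∈ Z, z ∈ a.1 ∧ w x z}
  have hU21 : ∀ s ∈ V, ∀ x, U2 s ⊆ U1 x := fun s hs x X hX => Or.inl ⟨s, hs, hX⟩
  have hU22 : ∀ s ∈ V, ∀ s' ∈ V, U2 s ⊆ U2 s' ∨ U2 s' ⊆ U2 s := by
    intro s hs s' hs'
    rcases le_total (s : ℝ) s' with hle | hle
    · exact Or.inr fun X hX => (hRmono s' hs' s hs hle).trans hX
    · exact Or.inl fun X hX => (hRmono s hs s' hs' hle).trans hX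
  have hU11 : ∀ x y, leW w x y → U1 y ⊆ U1 x := by
    rintro x y hxy X (hX | ⟨a, ha, haX, z, hz, hza, hyz⟩)
    · exact Or.inl hX
    · exact Or.inr ⟨a, ha, haX, z, hz, hza, leW_w w hxy hyz⟩
  apply chain_of_upsets A B hpre ((U2 '' V) ∪ (U1 '' K))
  · rintro _ (⟨s, hs, rfl⟩ | ⟨x, hx, rfl⟩) _ (⟨s', hs', rfl⟩ | ⟨y, hy, rfl⟩)
    · exact hU22 s hs s' hs'
    · exact Or.inl (hU21 s hs y)
    · exact Or.inr (hU21 s' hs' x)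
    · rcases leW_or w x y with hle | hle
      · exact Or.inr (hU11 x y hle)
      · exact Or.inl (hU11 y x (Or.inl hle))
  · rintro _ (⟨s, hs, rfl⟩ | ⟨x, hx, rfl⟩) X Y hXY hX
    · exact Set.Subset.trans hX hXY
    · rcases hX with ⟨s, hs, hX⟩ | ⟨a, ha, haX, hz⟩
      · exact Or.inl ⟨s, hs, Set.Subset.trans hX hXY⟩
      · exact Or.inr ⟨a, ha, haX.trans hXY, hz⟩
  · intro X
    by_cases hXU : X ∈ U
    · obtain ⟨s, hs, hsX⟩ := hXU
      obtain ⟨b, hb, hbs⟩ := hRB s hs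
      exact Or.inr ⟨U2 s, Or.inl ⟨s, hs, rfl⟩, hsX, b, hb, hbs⟩
    · left
      by_contra hcon
      have hall : ∀ x ∈ K, ∃ z ∈ Z, z ∈ X.1 ∧ w x z := by
        intro x hx
        by_contra hno
        apply hcon
        refine ⟨U1 x, Or.inr ⟨x, hx, rfl⟩, ?_, ?_⟩
        · rintro (hX | ⟨a, ha, haX, z, hz, hza, hxz⟩)
          · exact hXU hX
          · exact hno ⟨z, hz, haX hza, hxz⟩
        · obtain ⟨z, hz, hxz⟩ := hZ2 x hx
          obtain ⟨a, ha, hza⟩ := (hZ1 hz).1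
          exact ⟨a, ha, Or.inr ⟨a, ha, le_rfl, z, hz, hza, hxz⟩⟩
      obtain ⟨F, hF, hF', hXF⟩ := X.2
      have hG : ∃ G ∈ F, ∀ x ∈ K, ∃ z ∈ Z, z ∈ (⋂ g ∈ G, dseg w g) ∧ w x z := by
        by_contra hno
        push Not at hno
        choose! f hfK hf using hno
        obtain ⟨x, hx, hxb⟩ := finset_bound w K hKne (F.image f)
          (by simp only [Finset.mem_image]; rintro _ ⟨G, hG, rfl⟩; exact hfK G hG)
        obtain ⟨z, hz, hzX, hxz⟩ := hall x hx
        rw [hXF] at hzX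
        simp only [Set.mem_iUnion] at hzX
        obtain ⟨G, hG, hzG⟩ := hzX
        exact hf G hG z hz hzG (leW_w w (hxb _ (Finset.mem_image_of_mem f hG)) hxz)
      obtain ⟨G, hGF, hG⟩ := hG
      have hGK : ∀ g ∈ G, g ∉ K := by
        intro g hg hgK
        obtain ⟨z, -, hzG, hgz⟩ := hG g hgK
        simp only [Set.mem_iInter] at hzG
        exact not_w_of_leW w (hzG g hg).1 hgz
      obtain ⟨s, hsG, hsmin⟩ := Finset.exists_min_image G (fun g => (g : ℝ)) (hF' G hGF)
      have hsV : s ∈ V := by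
        refine ⟨hGK s hsG, hZ3 s (hGK s hsG) fun x hx => ?_⟩
        obtain ⟨z, hz, hzG, hxz⟩ := hG x hx
        simp only [Set.mem_iInter] at hzG
        exact ⟨z, hz, hxz, (hzG s hsG).2⟩
      apply hXU
      refine ⟨s, hsV, ?_⟩
      rw [hXF]
      intro z hz
      simp only [Set.mem_iUnion, Set.mem_iInter]
      refine ⟨G, hGF, fun g hg => ?_⟩
      obtain ⟨hd1, hd2, hd3⟩ := hd s hsV.1
      exact ⟨leW_trans w hz.1.1 (hd3 g (hGK g hg) (hsmin g hg)), hz.2.2.trans (hsmin g hg)⟩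
end

section
/- Let A and B be disjoint sets of maximal branches of the binary tree T₂. Then the pregap (A, B^c) in (𝒫(T₂), ≤_Fin) is separable if and only if A and B are covered (under inclusion) by disjoint F_σ subsets of 𝒫(T₂). -/
/-- The quasiorder `X ≤_Fin Y` iff `X \ Y` is finite. -/
def finLE {α : Type*} (X Y : Set α) : Prop := (X \ Y).Finite

/-- `(A, C)` is a pregap in `(𝒫(α), ≤_Fin)`. -/
def IsPregapF {α : Type*} (A C : Set (Set α)) : Prop :=
  ∀ X ∈ A, ∀ Y ∈ C, finLE X Y

/-- `(A, C)` is a gap in `(𝒫(α), ≤_Fin)`: a pregap with no separating element. -/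
def IsGapF {α : Type*} (A C : Set (Set α)) : Prop :=
  IsPregapF A C ∧ ¬ ∃ Z : Set α, (∀ X ∈ A, finLE X Z) ∧ ∀ Y ∈ C, finLE Z Y

/-- The binary tree `T₂` of finite 0–1 sequences, ordered by extension (`<+:`);
its maximal branches are its maximal chains, regarded as subsets of `T₂`. -/
def Branches : Set (Set (List Bool)) := {X | IsMaxChain (fun a b => a <+: b) X}

/-- The identification of `𝒫(T₂)` with `{0,1}^{T₂}` via characteristic functions. -/
noncomputable def chi (X : Set (List Bool)) : List Bool → Bool :=
  fun s => @decide (s ∈ X) (Classical.propDecidable _)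

/-- A set of subsets of `T₂` is closed when the corresponding set of characteristic
functions is closed in the product topology on `{0,1}^{T₂}`. -/
def IsClosedSets (A : Set (Set (List Bool))) : Prop := IsClosed (chi '' A)

/-- An `F_σ` set of subsets of `T₂`: a countable union of closed sets. -/
def IsFsigmaSets (A : Set (Set (List Bool))) : Prop :=
  ∃ f : ℕ → Set (Set (List Bool)), (∀ n, IsClosedSets (f n)) ∧ A = ⋃ n, f n

theorem chi_image (A : Set (Set (List Bool))) :
    chi '' A = {f | {s | f s = true} ∈ A} := by
  ext f
  constructor
  · rintro ⟨X, hX, rfl⟩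
    simpa [chi] using hX
  · intro h
    refine ⟨_, h, ?_⟩
    funext s
    simp [chi]

theorem branch_mem {X : Set (List Bool)} (hX : X ∈ Branches) (t : List Bool)
    (ht : ∀ u ∈ X, t <+: u ∨ u <+: t) : t ∈ X := by
  have h := hX.2 (t := insert t X) (hX.1.insert (fun u hu _ => ht u hu)) (Set.subset_insert _ _)
  rw [h]
  exact Set.mem_insert _ _

theorem branch_comp {X : Set (List Bool)} (hX : X ∈ Branches) {s t : List Bool}
    (hs : s ∈ X) (ht : t ∈ X) : s <+: t ∨ t <+: s := by
  by_cases h : s = t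
  · subst h; exact Or.inl (List.prefix_refl _)
  · exact hX.1 hs ht h

theorem branch_mem_iff {X : Set (List Bool)} (hX : X ∈ Branches) {s t : List Bool}
    (hs : s ∈ X) (hl : t.length ≤ s.length) : t ∈ X ↔ t <+: s := by
  constructor
  · intro ht
    rcases branch_comp hX hs ht with h | h
    · rw [h.eq_of_length_le hl]
    · exact h
  · intro h
    refine branch_mem hX t fun u hu => ?_
    rcases branch_comp hX hs hu with h' | h'
    · exact Or.inl (h.trans h')
    · exact List.prefix_or_prefix_of_prefix h h'

theorem branch_level {X : Set (List Bool)} (hX : X ∈ Branches) (n : ℕ) :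
    ∃ s ∈ X, s.length = n := by
  induction n with
  | zero => exact ⟨[], branch_mem hX [] (fun u _ => Or.inl List.nil_prefix), rfl⟩
  | succ n ih =>
    obtain ⟨s, hs, hn⟩ := ih
    by_contra! hc
    have key : s ++ [true] ∈ X := by
      refine branch_mem hX _ fun u hu => Or.inr ?_
      have hu' : u.length ≤ s.length := by
        by_contra! hlt
        have hmem : u.take (n + 1) ∈ X :=
          (branch_mem_iff hX hu (by simp)).2 (List.take_prefix _ _)
        exact hc _ hmem (by simp; omega)
      exact ((branch_mem_iff hX hs hu').1 hu).trans (List.prefix_append _ _)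
    exact hc _ key (by simp [hn])

theorem finite_length_le (n : ℕ) : {s : List Bool | s.length ≤ n}.Finite :=
  List.finite_length_le Bool n

theorem bounded_of_finite {S : Set (List Bool)} (h : S.Finite) :
    ∃ n, ∀ s ∈ S, s.length ≤ n := by
  obtain ⟨n, hn⟩ := (h.image List.length).bddAbove
  exact ⟨n, fun s hs => hn ⟨s, hs, rfl⟩⟩

theorem closed_aux (W : Set (List Bool)) (n : ℕ) :
    IsClosedSets {X | (∀ m : ℕ, ∃ s ∈ X, s.length = m) ∧ ∀ s ∈ X, s ∈ W → s.length ≤ n} := by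
  unfold IsClosedSets
  rw [chi_image]
  have h1 : ∀ s : List Bool, IsClosed {f : List Bool → Bool | f s = true} := fun s =>
    isClosed_eq (continuous_apply s) continuous_const
  have h2 : ∀ s : List Bool, IsClosed {f : List Bool → Bool | f s = false} := fun s =>
    isClosed_eq (continuous_apply s) continuous_const
  have : {f : List Bool → Bool | {s | f s = true} ∈
      {X : Set (List Bool) | (∀ m : ℕ, ∃ s ∈ X, s.length = m) ∧ ∀ s ∈ X, s ∈ W → s.length ≤ n}} =
      (⋂ m : ℕ, ⋃ s ∈ {s : List Bool | s.length = m}, {f : List Bool → Bool | f s = true}) ∩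
      ⋂ s ∈ {s : List Bool | s ∈ W ∧ ¬ s.length ≤ n}, {f : List Bool → Bool | f s = false} := by
    ext f
    simp only [Set.mem_setOf_eq, Set.mem_inter_iff, Set.mem_iInter, Set.mem_iUnion, exists_prop]
    refine and_congr (forall_congr' fun m => exists_congr fun s => and_comm) ?_
    refine forall_congr' fun s => ?_
    cases f s <;> simp
  rw [this]
  refine (isClosed_iInter fun m => ?_).inter (isClosed_biInter fun s _ => h2 s)
  exact Set.Finite.isClosed_biUnion ((finite_length_le m).subset fun s hs => le_of_eq hs)
    fun s _ => h1 s

theorem eventually_avoid {C : Set (Set (List Bool))} (hC : IsClosedSets C)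
    {X : Set (List Bool)} (hX : X ∈ Branches) (hXC : X ∉ C) :
    ∃ N, ∀ s ∈ X, N ≤ s.length → ¬ ∃ Y ∈ C, Y ∈ Branches ∧ s ∈ Y := by
  unfold IsClosedSets at hC
  rw [chi_image] at hC
  have hmem : chi X ∈ {f | {s | f s = true} ∈ C}ᶜ := by
    simpa [chi] using hXC
  obtain ⟨I, u, hu, hsub⟩ := isOpen_pi_iff.1 hC.isOpen_compl _ hmem
  obtain ⟨N, hN⟩ := bounded_of_finite I.finite_toSet
  refine ⟨N, ?_⟩
  rintro s hs hNs ⟨Y, hYC, hY, hsY⟩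
  have : chi Y ∈ {f | {s | f s = true} ∈ C}ᶜ := by
    apply hsub
    intro t ht
    have hl := (hN t ht).trans hNs
    have : chi Y t = chi X t := by
      simp [chi, branch_mem_iff hX hs hl, branch_mem_iff hY hsY hl]
    rw [this]
    exact (hu t ht).2
  apply this
  simpa [chi] using hYC

theorem eventually_avoid_le {f : ℕ → Set (Set (List Bool))} (hf : ∀ n, IsClosedSets (f n))
    {X : Set (List Bool)} (hX : X ∈ Branches) (hXf : X ∉ ⋃ n, f n) (k : ℕ) :
    ∃ N, ∀ s ∈ X, N ≤ s.length → ∀ i ≤ k, ¬ ∃ Y ∈ f i, Y ∈ Branches ∧ s ∈ Y := by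
  have hx : ∀ i, X ∉ f i := fun i hi => hXf (Set.mem_iUnion.2 ⟨i, hi⟩)
  choose N hN using fun i => eventually_avoid (hf i) hX (hx i)
  refine ⟨(Finset.range (k + 1)).sup N, fun s hs hl i hi => hN i s hs (le_trans ?_ hl)⟩
  exact Finset.le_sup (f := N) (Finset.mem_range.2 (by omega))

theorem separable_iff_Fsigma_covered (A B : Set (Set (List Bool)))
    (hA : A ⊆ Branches) (hB : B ⊆ Branches) (hAB : Disjoint A B) :
    (∃ Z : Set (List Bool), (∀ X ∈ A, finLE X Z) ∧ ∀ Y ∈ compl '' B, finLE Z Y) ↔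
      ∃ A' B' : Set (Set (List Bool)), IsFsigmaSets A' ∧ IsFsigmaSets B' ∧
        Disjoint A' B' ∧ A ⊆ A' ∧ B ⊆ B' := by
  constructor
  · rintro ⟨Z, hZA, hZB⟩
    refine ⟨_, _, ⟨_, closed_aux Zᶜ, rfl⟩, ⟨_, closed_aux Z, rfl⟩, ?_, ?_, ?_⟩
    · rw [Set.disjoint_left]
      intro X h1 h2
      obtain ⟨n, hl, hn⟩ := Set.mem_iUnion.1 h1
      obtain ⟨m, -, hm⟩ := Set.mem_iUnion.1 h2
      obtain ⟨s, hs, hlen⟩ := hl (n + m + 1)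
      by_cases hZ : s ∈ Z
      · have := hm s hs hZ
        omega
      · have := hn s hs hZ
        omega
    · intro X hX
      obtain ⟨n, hn⟩ := bounded_of_finite (hZA X hX)
      exact Set.mem_iUnion.2 ⟨n, branch_level (hA hX), fun s hs hz => hn s ⟨hs, hz⟩⟩
    · intro X hX
      obtain ⟨n, hn⟩ := bounded_of_finite (hZB _ ⟨X, hX, rfl⟩)
      exact Set.mem_iUnion.2 ⟨n, branch_level (hB hX), fun s hs hz => hn s ⟨hz, fun h => h hs⟩⟩
  · rintro ⟨_, _, ⟨f, hf, rfl⟩, ⟨g, hg, rfl⟩, hd, hAf, hBg⟩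
    refine ⟨{s | ∃ k, (∃ Y ∈ f k, Y ∈ Branches ∧ s ∈ Y) ∧
      ∀ i ≤ k, ¬ ∃ Y ∈ g i, Y ∈ Branches ∧ s ∈ Y}, ?_, ?_⟩
    · intro X hX
      obtain ⟨k, hk⟩ := Set.mem_iUnion.1 (hAf hX)
      obtain ⟨N, hN⟩ := eventually_avoid_le hg (hA hX) (Set.disjoint_left.1 hd (hAf hX)) k
      refine (finite_length_le N).subset ?_
      rintro s ⟨hs, hz⟩
      by_contra hc
      exact hz ⟨k, ⟨X, hk, hA hX, hs⟩, hN s hs (le_of_not_ge hc)⟩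
    · rintro _ ⟨X, hX, rfl⟩
      obtain ⟨k, hk⟩ := Set.mem_iUnion.1 (hBg hX)
      obtain ⟨N, hN⟩ := eventually_avoid_le hf (hB hX) (Set.disjoint_right.1 hd (hBg hX)) k
      refine (finite_length_le N).subset ?_
      rintro s ⟨⟨j, hj, hj'⟩, hs⟩
      have hs : s ∈ X := not_not.1 hs
      by_contra hc
      rcases le_total j k with h | h
      · exact hN s hs (le_of_not_ge hc) j h hj
      · exact hj' k h ⟨X, hk, hB hX, hs⟩
end

section
/- If A is a set of maximal branches of the binary tree T₂ such that A and B := 𝓑 \ A are both dense in the space 𝓑 of maximal branches, then (A, B^c) is a gap in (𝒫(T₂), ≤_Fin). -/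
theorem inf_of_long {S : Set (List Bool)} (h : ∀ n, ∃ s ∈ S, n < s.length) : S.Infinite := by
  intro hf
  obtain ⟨m, hm⟩ := (hf.image List.length).bddAbove
  obtain ⟨s, hs, hl⟩ := h m
  have := hm ⟨s, hs, rfl⟩
  omega

theorem long_of_inf {S : Set (List Bool)} (h : S.Infinite) (n : ℕ) :
    ∃ s ∈ S, n < s.length := by
  by_contra hc
  push Not at hc
  exact h ((List.finite_length_le Bool n).subset fun s hs => hc s hs)

theorem chain_cmp {X : Set (List Bool)} (h : X ∈ Branches) {a b : List Bool}
    (ha : a ∈ X) (hb : b ∈ X) : a <+: b ∨ b <+: a := by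
  by_cases e : a = b
  · subst e; exact Or.inl (List.prefix_refl a)
  · exact h.1 ha hb e

theorem chain_pre {X : Set (List Bool)} (h : X ∈ Branches) {a b : List Bool}
    (ha : a ∈ X) (hb : b ∈ X) (hl : a.length ≤ b.length) : a <+: b := by
  rcases chain_cmp h ha hb with h1 | h1
  · exact h1
  · have := h1.eq_of_length_le hl
    subst this; exact h1

theorem mem_of_cmp {X : Set (List Bool)} (h : X ∈ Branches) {a : List Bool}
    (hc : ∀ b ∈ X, a <+: b ∨ b <+: a) : a ∈ X := by
  have hch : IsChain (fun a b : List Bool => a <+: b) (insert a X) :=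
    h.1.insert fun b hb _ => hc b hb
  have := h.2 hch (Set.subset_insert a X)
  rw [this]; exact Set.mem_insert a X

theorem branch_down {X : Set (List Bool)} (h : X ∈ Branches) {a b : List Bool}
    (hb : b ∈ X) (hab : a <+: b) : a ∈ X := by
  refine mem_of_cmp h fun c hc => ?_
  rcases chain_cmp h hb hc with h1 | h1
  · exact Or.inl (hab.trans h1)
  · exact List.prefix_or_prefix_of_prefix hab h1

theorem branch_inf {X : Set (List Bool)} (h : X ∈ Branches) : X.Infinite := by
  intro hf
  have hne : X.Nonempty := ⟨[], mem_of_cmp h fun b _ => Or.inl List.nil_prefix⟩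
  obtain ⟨m, hm, hmax⟩ := hf.exists_maximalFor List.length X hne
  have : m ++ [true] ∈ X := by
    refine mem_of_cmp h fun b hb => Or.inr ?_
    have hl : b.length ≤ m.length := by
      rcases le_total b.length m.length with h1 | h1
      · exact h1
      · exact hmax hb h1
    exact (chain_pre h hb hm hl).trans (List.prefix_append m [true])
  have h2 := hmax this (by simp)
  simp at h2

theorem branch_subset {X Y : Set (List Bool)} (hX : X ∈ Branches) (hY : Y ∈ Branches)
    (hi : (X ∩ Y).Infinite) : X ⊆ Y := by
  intro x hx
  obtain ⟨z, hz, hl⟩ := long_of_inf hi x.length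
  exact branch_down hY hz.2 (chain_pre hX hx hz.1 hl.le)

theorem dense_through {D : Set (Set (List Bool))}
    (hD : chi '' Branches ⊆ closure (chi '' D)) (s : List Bool) : ∃ X ∈ D, s ∈ X := by
  obtain ⟨M, hM, hs⟩ := (IsChain.singleton (r := fun a b : List Bool => a <+: b)
    (a := s)).exists_maxChain
  have h1 := hD ⟨M, hM, rfl⟩
  have hopen : IsOpen {f : List Bool → Bool | f s = true} :=
    IsOpen.preimage (f := fun p : List Bool → Bool => p s) (continuous_apply s)
      (isOpen_discrete ({true} : Set Bool))
  have hMs : s ∈ M := hs rfl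
  obtain ⟨_, hf, X, hX, rfl⟩ := mem_closure_iff.1 h1 _ hopen (by simp [chi, hMs])
  exact ⟨X, hX, by simpa [chi] using hf⟩

theorem step_ext {D : Set (Set (List Bool))} (hDB : D ⊆ Branches)
    (hD : chi '' Branches ⊆ closure (chi '' D)) (W : Set (List Bool))
    (hW : ∀ X ∈ D, (X \ W).Finite) (s : List Bool) :
    ∃ t ∈ W, s <+: t ∧ s.length < t.length := by
  obtain ⟨X, hX, hs⟩ := dense_through hD s
  have hi : (X \ (X \ W)).Infinite := (branch_inf (hDB hX)).sdiff (hW X hX)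
  obtain ⟨t, ht, hl⟩ := long_of_inf hi s.length
  refine ⟨t, ?_, chain_pre (hDB hX) hs ht.1 hl.le, hl⟩
  by_contra hc
  exact ht.2 ⟨ht.1, hc⟩

theorem dense_split_is_gap (A : Set (Set (List Bool))) (hA : A ⊆ Branches)
    (hAdense : chi '' Branches ⊆ closure (chi '' A))
    (hBdense : chi '' Branches ⊆ closure (chi '' (Branches \ A))) :
    IsGapF A (compl '' (Branches \ A)) := by
  constructor
  · rintro X hX _ ⟨Y, ⟨hY, hYA⟩, rfl⟩
    by_contra hi
    have hi : (X ∩ Y).Infinite := by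
      intro hf
      apply hi
      unfold finLE
      rwa [Set.sdiff_compl]
    have h1 := branch_subset (hA hX) hY hi
    have h2 := branch_subset hY (hA hX) (by rwa [Set.inter_comm])
    exact hYA (h1.antisymm h2 ▸ hX)
  · rintro ⟨Z, hZA, hZB⟩
    have hB : ∀ Y ∈ Branches \ A, (Y \ Zᶜ).Finite := by
      intro Y hY
      have := hZB _ ⟨Y, hY, rfl⟩
      unfold finLE at this
      rw [Set.sdiff_compl] at this ⊢
      rwa [Set.inter_comm]
    choose f hfZ hfp hfl using step_ext hA hAdense Z hZA
    choose g hgZ hgp hgl using step_ext Set.sdiff_subset hBdense Zᶜ hB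
    let v : ℕ → List Bool := fun n => (fun s => g (f s))^[n] []
    have hv : ∀ n, v (n + 1) = g (f (v n)) := fun n => Function.iterate_succ_apply' _ _ _
    have hlen : ∀ n, n ≤ (v n).length := by
      intro n
      induction n with
      | zero => simp
      | succ n ih =>
        rw [hv]
        have := hfl (v n)
        have := hgl (f (v n))
        omega
    have hmono : ∀ m n, m ≤ n → v m <+: v n := by
      intro m n hmn
      induction n, hmn using Nat.le_induction with
      | base => exact List.prefix_refl _
      | succ n _ ih => rw [hv]; exact (ih.trans (hfp _)).trans (hgp _)
    have hch : IsChain (fun a b : List Bool => a <+: b) (Set.range v) := by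
      rintro _ ⟨m, rfl⟩ _ ⟨n, rfl⟩ _
      exact (le_total m n).imp (hmono m n) (hmono n m)
    obtain ⟨X, hX, hvX⟩ := hch.exists_maxChain
    have hX : X ∈ Branches := hX
    have hmem : ∀ n, v n ∈ X := fun n => hvX ⟨n, rfl⟩
    by_cases hXA : X ∈ A
    · refine inf_of_long (S := X \ Z) (fun n => ⟨v (n + 1), ⟨hmem _, ?_⟩, hlen (n + 1)⟩) (hZA X hXA)
      rw [hv]; exact hgZ _
    · refine inf_of_long (S := X \ Zᶜ) (fun n => ⟨f (v n), ⟨?_, ?_⟩, ?_⟩) (hB X ⟨hX, hXA⟩)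
      · refine branch_down hX (hmem (n + 1)) ?_
        rw [hv]; exact hgp _
      · exact fun h => h (hfZ _)
      · exact (hlen n).trans_lt (hfl _)
end

section
/- Let A and B be disjoint sets of maximal branches of the binary tree T₂. If (A, B^c) is a gap in (𝒫(T₂), ≤_Fin), then (A, B^c) does not contain a regular irreducible subgap. -/
/-- A pair `(A, C)` is regular if `|A|` and `|C|` are both regular cardinals,
or one is regular and the other is zero. -/
def RegularPair {α : Type*} (A C : Set α) : Prop :=
  ((Cardinal.mk ↥A).IsRegular ∧ (Cardinal.mk ↥C).IsRegular) ∨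
  ((Cardinal.mk ↥A).IsRegular ∧ Cardinal.mk ↥C = 0) ∨
  (Cardinal.mk ↥A = 0 ∧ (Cardinal.mk ↥C).IsRegular)

/-- A gap `(A, C)` in `(𝒫(α), ≤_Fin)` is irreducible if a subpair of `(A, C)` is a gap
exactly when it has the same cardinality as `(A, C)`. -/
def IrreducibleGapF {α : Type*} (A C : Set (Set α)) : Prop :=
  IsGapF A C ∧ ∀ A' ⊆ A, ∀ C' ⊆ C,
    (IsGapF A' C' ↔ (Cardinal.mk ↥A' = Cardinal.mk ↥A ∧ Cardinal.mk ↥C' = Cardinal.mk ↥C))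

theorem br_comp {X : Set (List Bool)} (hX : X ∈ Branches) {a b : List Bool} (ha : a ∈ X) (hb : b ∈ X) :
    a <+: b ∨ b <+: a := by
  by_cases h : a = b
  · left; rw [h]
  · exact hX.1 ha hb h

theorem br_insert {X : Set (List Bool)} (hX : X ∈ Branches) {a : List Bool}
    (h : ∀ b ∈ X, a <+: b ∨ b <+: a) : a ∈ X := by
  have := hX.2 (t := insert a X) (hX.1.insert fun b hb _ => h b hb) (Set.subset_insert _ _)
  rw [this]; exact Set.mem_insert _ _

theorem br_down {X : Set (List Bool)} (hX : X ∈ Branches) {a b : List Bool} (hb : b ∈ X)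
    (hab : a <+: b) : a ∈ X := by
  apply br_insert hX
  intro c hc
  rcases br_comp hX hb hc with h | h
  · exact Or.inl (hab.trans h)
  · exact List.prefix_or_prefix_of_prefix hab h

theorem br_uniq {X : Set (List Bool)} (hX : X ∈ Branches) {a b : List Bool} (ha : a ∈ X) (hb : b ∈ X)
    (h : a.length = b.length) : a = b := by
  rcases br_comp hX ha hb with h' | h'
  · exact h'.eq_of_length h
  · exact (h'.eq_of_length h.symm).symm

theorem br_node {X : Set (List Bool)} (hX : X ∈ Branches) (n : ℕ) : ∃ w ∈ X, w.length = n := by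
  induction n with
  | zero => exact ⟨[], br_insert hX (fun b _ => Or.inl List.nil_prefix), rfl⟩
  | succ n ih =>
    obtain ⟨w, hw, hl⟩ := ih
    by_cases h : ∃ v ∈ X, n < v.length
    · obtain ⟨v, hv, hlv⟩ := h
      exact ⟨v.take (n+1), br_down hX hv (List.take_prefix _ _), by simp; omega⟩
    · push Not at h
      refine ⟨w ++ [true], br_insert hX ?_, by simp [hl]⟩
      intro b hb
      right
      have : b <+: w := by
        rcases br_comp hX hw hb with h' | h'
        · have := h'.length_le
          have h2 := h b hb
          rw [h'.eq_of_length (by omega)]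
        · exact h'
      exact this.trans (List.prefix_append _ _)

theorem br_compat {X : Set (List Bool)} (hX : X ∈ Branches) {s w : List Bool} (hw : w ∈ X)
    (hs : s ∉ X) : ¬ s <+: w := fun h => hs (br_down hX hw h)

def SepF (A B : Set (Set (List Bool))) : Prop :=
  ∃ Z : Set (List Bool), (∀ X ∈ A, (X \ Z).Finite) ∧ ∀ Y ∈ B, (Y ∩ Z).Finite

theorem SepF.symm {A B : Set (Set (List Bool))} (h : SepF A B) : SepF B A := by
  obtain ⟨Z, h1, h2⟩ := h
  refine ⟨Zᶜ, fun X hX => ?_, fun Y hY => ?_⟩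
  · simpa [Set.diff_eq] using h2 X hX
  · simpa [Set.diff_eq] using h1 Y hY

theorem lists_finite (n : ℕ) : {w : List Bool | w.length ≤ n}.Finite := by
  exact List.finite_length_le Bool n

theorem br_inter_finite {X Y : Set (List Bool)} (hX : X ∈ Branches) (m : List Bool)
    (hm : m ∈ Y) (hY : ∀ a ∈ Y, ∀ b ∈ Y, a <+: b ∨ b <+: a)
    (hmX : m ∉ X) : (X ∩ Y).Finite := by
  apply (lists_finite m.length).subset
  rintro w ⟨hw, hwY⟩
  rcases hY _ hm _ hwY with h | h
  · exact absurd h (br_compat hX hw hmX)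
  · exact h.length_le

theorem br_ne {X Y : Set (List Bool)} (hX : X ∈ Branches) (hY : Y ∈ Branches) (h : X ≠ Y) :
    ∃ m ∈ Y, m ∉ X := by
  by_contra hc
  push Not at hc
  exact h (hY.2 hX.1 hc).symm

theorem case_countable {A B : Set (Set (List Bool))} (hA : A ⊆ Branches) (hB : B ⊆ Branches)
    (hAB : Disjoint A B) (hcA : Cardinal.mk A = Cardinal.aleph0)
    (hcB : Cardinal.aleph0 ≤ Cardinal.mk B) :
    ∃ A' ⊆ A, ∃ B' ⊆ B, Cardinal.mk A' = Cardinal.mk A ∧ Cardinal.mk B' = Cardinal.mk B ∧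
      SepF A' B' := by
  have hAinf : A.Infinite := by
    rw [← Set.infinite_coe_iff, Cardinal.infinite_iff, hcA]
  let P : List Bool → Prop := fun s => (A ∩ {X | s ∈ X}).Infinite
  have step : ∀ s, P s → ∃ t, P t ∧ s <+: t ∧ t.length = s.length + 1 := by
    intro s hs
    by_contra hc
    push Not at hc
    have h1 : ∀ b, ¬ P (s ++ [b]) := fun b hb =>
      hc (s ++ [b]) hb (List.prefix_append _ _) (by simp)
    have h2 : ∀ b, (A ∩ {X | s ++ [b] ∈ X}).Finite := fun b => Set.not_infinite.1 (h1 b)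
    apply hs
    apply ((h2 true).union (h2 false)).subset
    rintro X ⟨hXA, hsX⟩
    have hsX : s ∈ X := hsX
    obtain ⟨w, hw, hwl⟩ := br_node (hA hXA) (s.length + 1)
    have hsw : s <+: w := by
      rcases br_comp (hA hXA) hsX hw with h | h
      · exact h
      · have := h.length_le; omega
    obtain ⟨t, rfl⟩ := hsw
    have ht : t.length = 1 := by simpa using hwl
    obtain ⟨b, rfl⟩ := List.length_eq_one_iff.1 ht
    cases b
    · right; exact ⟨hXA, hw⟩
    · left; exact ⟨hXA, hw⟩
  choose! f hf1 hf2 hf3 using step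
  let x : ℕ → List Bool := fun n => f^[n] []
  have hx0 : P [] := by
    apply hAinf.mono
    intro X hX
    exact ⟨hX, br_insert (hA hX) (fun b _ => Or.inl List.nil_prefix)⟩
  have hxs : ∀ n, x (n+1) = f (x n) := fun n => Function.iterate_succ_apply' f n []
  have hxP : ∀ n, P (x n) := by
    intro n
    induction n with
    | zero => exact hx0
    | succ n ih => rw [hxs]; exact hf1 _ ih
  have hxl : ∀ n, (x n).length = n := by
    intro n
    induction n with
    | zero => rfl
    | succ n ih => rw [hxs, hf3 _ (hxP n), ih]
  have hxm : ∀ m n, m ≤ n → x m <+: x n := by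
    intro m n h
    induction n, h using Nat.le_induction with
    | base => exact List.prefix_refl _
    | succ n _ ih => rw [hxs]; exact ih.trans (hf2 _ (hxP n))
  let R : Set (List Bool) := Set.range x
  have hRc : ∀ a ∈ R, ∀ b ∈ R, a <+: b ∨ b <+: a := by
    rintro _ ⟨m, rfl⟩ _ ⟨n, rfl⟩
    rcases le_total m n with h | h
    · exact Or.inl (hxm _ _ h)
    · exact Or.inr (hxm _ _ h)
  have hleave : ∀ X ∈ Branches, X ≠ R → ∃ m, x m ∉ X := by
    intro X hX hne
    by_contra hc
    push Not at hc
    apply hne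
    apply Set.Subset.antisymm
    · intro w hw
      exact ⟨w.length, br_uniq hX (hc _) hw (hxl _)⟩
    · rintro _ ⟨n, rfl⟩; exact hc n
  have hex : ∀ n, ∃ X ∈ A, x n ∈ X ∧ X ≠ R := by
    intro n
    obtain ⟨X, hX, hXR⟩ := ((hxP n).diff (Set.finite_singleton R)).nonempty
    exact ⟨X, hX.1, hX.2, hXR⟩
  choose a haA hax haR using hex
  have hrange : (Set.range a).Infinite := by
    intro hfin
    have hl : ∀ X ∈ Set.range a, ∃ m, x m ∉ X := by
      rintro _ ⟨n, rfl⟩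
      exact hleave _ (hA (haA n)) (haR n)
    choose! g hg using hl
    obtain ⟨M, hM⟩ := (hfin.image g).bddAbove
    have h1 : g (a M) ≤ M := hM ⟨a M, ⟨M, rfl⟩, rfl⟩
    exact hg (a M) ⟨M, rfl⟩ (br_down (hA (haA M)) (hax M) (hxm _ _ h1))
  have hsub : Set.range a ⊆ A := by rintro _ ⟨n, rfl⟩; exact haA n
  refine ⟨Set.range a, hsub, B \ {R}, Set.diff_subset, ?_, ?_, ?_⟩
  · apply le_antisymm (Cardinal.mk_le_mk_of_subset hsub)
    rw [hcA, ← Cardinal.infinite_iff, Set.infinite_coe_iff]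
    exact hrange
  · apply le_antisymm (Cardinal.mk_le_mk_of_subset Set.diff_subset)
    by_contra hlt
    push Not at hlt
    have h1 : Cardinal.mk B ≤ Cardinal.mk (B \ {R} : Set _) + Cardinal.mk ({R} : Set (Set (List Bool))) := by
      refine le_trans (Cardinal.mk_le_mk_of_subset ?_) (Cardinal.mk_union_le _ _)
      intro Y hY
      by_cases h : Y = R
      · right; exact h
      · left; exact ⟨hY, h⟩
    refine absurd h1 (not_le.2 (Cardinal.add_lt_of_lt hcB hlt ?_))
    rw [Cardinal.mk_singleton]
    exact lt_of_lt_of_le Cardinal.one_lt_aleph0 hcB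
  · refine ⟨(⋃ n, a n) \ R, ?_, ?_⟩
    · rintro _ ⟨n, rfl⟩
      obtain ⟨m, hm⟩ := hleave _ (hA (haA n)) (haR n)
      apply (br_inter_finite (Y := R) (hA (haA n)) (x m) (Set.mem_range_self m) hRc hm).subset
      rintro w ⟨hw, hw2⟩
      refine ⟨hw, ?_⟩
      by_contra h
      exact hw2 ⟨Set.mem_iUnion.2 ⟨n, hw⟩, h⟩
    · rintro Y ⟨hY, hYR⟩
      obtain ⟨m, hm⟩ := hleave _ (hB hY) hYR
      have hfin : ∀ n, (Y ∩ a n).Finite := by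
        intro n
        have hne : Y ≠ a n := by
          rintro rfl
          exact Set.disjoint_left.1 hAB (haA n) hY
        obtain ⟨k, hk, hk2⟩ := br_ne (hB hY) (hA (haA n)) hne
        exact br_inter_finite (hB hY) k hk (fun p hp q hq => br_comp (hA (haA n)) hp hq) hk2
      apply ((lists_finite m).union
        ((Set.finite_lt_nat m).biUnion (fun n _ => hfin n))).subset
      rintro w ⟨hwY, hwU, -⟩
      obtain ⟨n, hwn⟩ := Set.mem_iUnion.1 hwU
      by_cases hn : n < m
      · right
        exact Set.mem_biUnion (show n ∈ {i | i < m} from hn) ⟨hwY, hwn⟩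
      · left
        push Not at hn
        have hxma : x m ∈ a n := br_down (hA (haA n)) (hax n) (hxm _ _ hn)
        rcases br_comp (hA (haA n)) hxma hwn with h | h
        · exact absurd h (br_compat (hB hY) hwY hm)
        · have := h.length_le
          rw [hxl] at this
          exact this

theorem exists_node {B : Set (Set (List Bool))} (hB : B ⊆ Branches)
    (hr : (Cardinal.mk B).IsRegular) (n : ℕ) :
    ∃ u : List Bool, u.length = n ∧ Cardinal.mk (B ∩ {X | u ∈ X} : Set _) = Cardinal.mk B := by
  by_contra hc
  push Not at hc
  have hlt : ∀ u : List.Vector Bool n,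
      Cardinal.mk (B ∩ {X | u.1 ∈ X} : Set _) < Cardinal.mk B := fun u =>
    lt_of_le_of_ne (Cardinal.mk_le_mk_of_subset Set.inter_subset_left) (hc u.1 u.2)
  have hle : Cardinal.mk B ≤ Cardinal.mk (⋃ u : List.Vector Bool n, B ∩ {X | u.1 ∈ X} : Set _) := by
    apply Cardinal.mk_le_mk_of_subset
    intro X hX
    obtain ⟨w, hw, hl⟩ := br_node (hB hX) n
    exact Set.mem_iUnion.2 ⟨⟨w, hl⟩, hX, hw⟩
  refine absurd hle (not_le.2 ?_)
  rw [Cardinal.card_iUnion_lt_iff_forall_of_isRegular hr]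
  · exact hlt
  · exact lt_of_lt_of_le (Cardinal.lt_aleph0_of_finite _) hr.aleph0_le

theorem exists_two {A : Set (Set (List Bool))} (hA : A ⊆ Branches)
    (hr : (Cardinal.mk A).IsRegular) (hu : Cardinal.aleph0 < Cardinal.mk A) :
    ∃ s t : List Bool, s.length = t.length ∧ s ≠ t ∧
      Cardinal.mk (A ∩ {X | s ∈ X} : Set _) = Cardinal.mk A ∧
      Cardinal.mk (A ∩ {X | t ∈ X} : Set _) = Cardinal.mk A := by
  by_contra hc
  push Not at hc
  choose s hsl hsA using exists_node hA hr
  let I := {u : List Bool // u ≠ s u.length}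
  have hlt : ∀ u : I, Cardinal.mk (A ∩ {X | u.1 ∈ X} : Set _) < Cardinal.mk A := fun u =>
    lt_of_le_of_ne (Cardinal.mk_le_mk_of_subset Set.inter_subset_left)
      (hc (s u.1.length) u.1 (hsl _) (fun h => u.2 h.symm) (hsA _))
  let D : Set (Set (List Bool)) := {X | X ∈ A ∧ ∀ n, s n ∈ X}
  have hD : Cardinal.mk D < Cardinal.mk A := by
    have : Cardinal.mk D ≤ 1 := by
      rw [Cardinal.le_one_iff_subsingleton, Set.subsingleton_coe]
      have key : ∀ X ∈ D, X = Set.range s := by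
        intro X hX
        apply Set.Subset.antisymm
        · intro w hw
          exact ⟨w.length, br_uniq (hA hX.1) (hX.2 _) hw (hsl _)⟩
        · rintro _ ⟨n, rfl⟩; exact hX.2 n
      intro X hX Y hY
      rw [key X hX, key Y hY]
    exact this.trans_lt (Cardinal.one_lt_aleph0.trans hu)
  have hle : Cardinal.mk A ≤
      Cardinal.mk (⋃ u : I, A ∩ {X | u.1 ∈ X} : Set _) + Cardinal.mk D := by
    refine le_trans (Cardinal.mk_le_mk_of_subset ?_) (Cardinal.mk_union_le _ _)
    intro X hX
    by_cases h : ∀ n, s n ∈ X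
    · right; exact ⟨hX, h⟩
    · left
      push Not at h
      obtain ⟨n, hn⟩ := h
      obtain ⟨w, hw, hl⟩ := br_node (hA hX) n
      refine Set.mem_iUnion.2 ⟨⟨w, ?_⟩, hX, hw⟩
      rw [hl]
      rintro rfl
      exact hn hw
  refine absurd hle (not_le.2 (Cardinal.add_lt_of_lt hr.aleph0_le ?_ hD))
  rw [Cardinal.card_iUnion_lt_iff_forall_of_isRegular hr]
  · exact hlt
  · exact lt_of_le_of_lt (Cardinal.mk_le_aleph0) hu

theorem case_uncountable {A B : Set (Set (List Bool))} (hA : A ⊆ Branches) (hB : B ⊆ Branches)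
    (hrA : (Cardinal.mk A).IsRegular) (hrB : (Cardinal.mk B).IsRegular)
    (hu : Cardinal.aleph0 < Cardinal.mk A) :
    ∃ A' ⊆ A, ∃ B' ⊆ B, Cardinal.mk A' = Cardinal.mk A ∧ Cardinal.mk B' = Cardinal.mk B ∧
      SepF A' B' := by
  obtain ⟨s, t, hl, hne, hs, ht⟩ := exists_two hA hrA hu
  obtain ⟨u, hul, hub⟩ := exists_node hB hrB s.length
  have : ∃ v, v.length = u.length ∧ v ≠ u ∧
      Cardinal.mk (A ∩ {X | v ∈ X} : Set _) = Cardinal.mk A := by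
    by_cases h : s = u
    · exact ⟨t, by omega, fun h' => hne (h.trans h'.symm), ht⟩
    · exact ⟨s, by omega, h, hs⟩
  obtain ⟨v, hvl, hvu, hv⟩ := this
  refine ⟨_, Set.inter_subset_left, _, Set.inter_subset_left, hv, hub, {w | v <+: w}, ?_, ?_⟩
  · rintro X ⟨hXA, hvX⟩
    apply (lists_finite v.length).subset
    rintro w ⟨hw, hw2⟩
    rcases br_comp (hA hXA) hvX hw with h | h
    · exact absurd h hw2
    · exact h.length_le
  · rintro Y ⟨hYB, huY⟩
    convert Set.finite_empty
    ext w
    simp only [Set.mem_inter_iff, Set.mem_setOf_eq, Set.mem_empty_iff_false, iff_false]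
    rintro ⟨hw, hvw⟩
    exact hvu (br_uniq (hB hYB) (br_down (hB hYB) hw hvw) huY hvl)

theorem main_sep {A B : Set (Set (List Bool))} (hA : A ⊆ Branches) (hB : B ⊆ Branches)
    (hAB : Disjoint A B)
    (hrA : (Cardinal.mk A).IsRegular) (hrB : (Cardinal.mk B).IsRegular) :
    ∃ A' ⊆ A, ∃ B' ⊆ B, Cardinal.mk A' = Cardinal.mk A ∧ Cardinal.mk B' = Cardinal.mk B ∧
      SepF A' B' := by
  rcases hrA.aleph0_le.eq_or_lt with h | h
  · exact case_countable hA hB hAB h.symm hrB.aleph0_le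
  · exact case_uncountable hA hB hrA hrB h

theorem branch_gap_no_regular_irreducible_subgap (A B : Set (Set (List Bool)))
    (hA : A ⊆ Branches) (hB : B ⊆ Branches) (hAB : Disjoint A B)
    (hgap : IsGapF A (compl '' B)) :
    ¬ ∃ A' C' : Set (Set (List Bool)), A' ⊆ A ∧ C' ⊆ compl '' B ∧
        RegularPair A' C' ∧ IrreducibleGapF A' C' := by
  rintro ⟨A', C', hA', hC', hreg, hgap', hirr⟩
  rcases hreg with ⟨h1, h2⟩ | ⟨-, h⟩ | ⟨h, -⟩
  · have hcard : ∀ S : Set (Set (List Bool)), Cardinal.mk (compl '' S : Set _) = Cardinal.mk S :=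
      fun S => Cardinal.mk_image_eq compl_injective
    have hsub : compl '' C' ⊆ B := by
      rintro _ ⟨Y, hY, rfl⟩
      obtain ⟨W, hW, rfl⟩ := hC' hY
      rwa [compl_compl]
    obtain ⟨A₁, hA₁, B₁, hB₁, hc1, hc2, Z, hZ1, hZ2⟩ := main_sep (hA'.trans hA) (hsub.trans hB)
      (hAB.mono hA' hsub) h1 (by rw [hcard]; exact h2)
    have hC₁ : compl '' B₁ ⊆ C' := by
      rintro _ ⟨Y, hY, rfl⟩
      obtain ⟨W, hW, rfl⟩ := hB₁ hY
      rwa [compl_compl]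
    have hg := (hirr A₁ hA₁ (compl '' B₁) hC₁).2 ⟨hc1, by rw [hcard, hc2, hcard]⟩
    apply hg.2
    refine ⟨Z, hZ1, ?_⟩
    rintro _ ⟨Y, hY, rfl⟩
    have := hZ2 Y hY
    unfold finLE
    rwa [Set.diff_compl, Set.inter_comm]
  · apply hgap'.2
    rw [Cardinal.mk_eq_zero_iff, Set.isEmpty_coe_sort] at h
    subst h
    exact ⟨Set.univ, fun X _ => by simp [finLE], by simp⟩
  · apply hgap'.2
    rw [Cardinal.mk_eq_zero_iff, Set.isEmpty_coe_sort] at h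
    subst h
    exact ⟨∅, by simp, fun X _ => by simp [finLE]⟩
end

section
/- Let D be an infinite set of maximal branches of the binary tree T₂, and let Ď := {s ∈ T₂ : |{X ∈ D : s ∈ X}| = |D|}. Then Ď contains a maximal branch of T₂ (in particular Ď is infinite); moreover, if |D| is a regular uncountable cardinal, then Ď is not a chain of T₂. -/
/-- `Ď`: the set of nodes of `T₂` belonging to as many members of `D` as possible. -/
def checkSet (D : Set (Set (List Bool))) : Set (List Bool) :=
  {s | Cardinal.mk ↥{X : Set (List Bool) | X ∈ D ∧ s ∈ X} = Cardinal.mk ↥D}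

theorem br_prefix {X : Set (List Bool)} (hX : X ∈ Branches) {s t : List Bool} (hs : s ∈ X)
    (h : t <+: s) : t ∈ X := by
  have hc : IsChain (fun a b : List Bool => a <+: b) (insert t X) := by
    refine hX.1.insert ?_
    intro x hx _
    by_cases hxs : x = s
    · subst hxs; exact Or.inl h
    rcases hX.1 hx hs hxs with h1 | h1
    · exact List.prefix_or_prefix_of_prefix h h1
    · exact Or.inl (h.trans h1)
  have := hX.2 hc (Set.subset_insert t X)
  rw [this]; exact Set.mem_insert _ _

theorem br_nil {X : Set (List Bool)} (hX : X ∈ Branches) : [] ∈ X := by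
  have hc : IsChain (fun a b : List Bool => a <+: b) (insert [] X) := by
    refine hX.1.insert ?_
    intro x hx _
    exact Or.inl List.nil_prefix
  have := hX.2 hc (Set.subset_insert [] X)
  rw [this]; exact Set.mem_insert _ _

theorem br_succ {X : Set (List Bool)} (hX : X ∈ Branches) {s : List Bool} (hs : s ∈ X) :
    s ++ [false] ∈ X ∨ s ++ [true] ∈ X := by
  by_cases hl : ∃ x ∈ X, ¬ x <+: s
  · obtain ⟨x, hx, hn⟩ := hl
    have hne : x ≠ s := by rintro rfl; exact hn (List.prefix_refl _)
    rcases hX.1 hx hs hne with h | h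
    · exact absurd h hn
    · obtain ⟨u, rfl⟩ := h
      cases u with
      | nil => simp at hne
      | cons b u =>
        have : s ++ [b] ∈ X := br_prefix hX hx ⟨u, by simp⟩
        cases b
        · exact Or.inl this
        · exact Or.inr this
  · push Not at hl
    left
    have hc : IsChain (fun a b : List Bool => a <+: b) (insert (s ++ [false]) X) := by
      refine hX.1.insert ?_
      intro x hx _
      exact Or.inr ((hl x hx).trans (List.prefix_append _ _))
    have := hX.2 hc (Set.subset_insert _ X)
    rw [this]; exact Set.mem_insert _ _

theorem check_succ {D : Set (Set (List Bool))} (hD : D ⊆ Branches) (hinf : D.Infinite)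
    (s : List Bool) (hs : s ∈ checkSet D) : ∃ b, s ++ [b] ∈ checkSet D := by
  by_contra hcon
  push Not at hcon
  have hle : ∀ b, Cardinal.mk ↥{X : Set (List Bool) | X ∈ D ∧ s ++ [b] ∈ X} < Cardinal.mk ↥D :=
    fun b => lt_of_le_of_ne (Cardinal.mk_le_mk_of_subset fun X hX => hX.1) (hcon b)
  have h0 : Cardinal.aleph0 ≤ Cardinal.mk ↥D := Cardinal.infinite_iff.mp hinf.to_subtype
  have hsub : {X : Set (List Bool) | X ∈ D ∧ s ∈ X} ⊆
      {X | X ∈ D ∧ s ++ [false] ∈ X} ∪ {X | X ∈ D ∧ s ++ [true] ∈ X} := by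
    rintro X ⟨hX, hsX⟩
    rcases br_succ (hD hX) hsX with h | h
    · exact Or.inl ⟨hX, h⟩
    · exact Or.inr ⟨hX, h⟩
  have := ((Cardinal.mk_le_mk_of_subset hsub).trans (Cardinal.mk_union_le _ _)).trans_lt
    (Cardinal.add_lt_of_lt h0 (hle false) (hle true))
  exact absurd hs this.ne

theorem checkSet_properties (D : Set (Set (List Bool))) (hD : D ⊆ Branches)
    (hinf : D.Infinite) :
    (∃ b ∈ Branches, b ⊆ checkSet D) ∧ (checkSet D).Infinite ∧
      ((Cardinal.mk ↥D).IsRegular → Cardinal.aleph0 < Cardinal.mk ↥D →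
        ¬ IsChain (fun a b => a <+: b) (checkSet D)) := by
  have h0 : [] ∈ checkSet D := by
    have : {X : Set (List Bool) | X ∈ D ∧ [] ∈ X} = D := by
      ext X; exact ⟨fun h => h.1, fun h => ⟨h, br_nil (hD h)⟩⟩
    change Cardinal.mk ↥{X : Set (List Bool) | X ∈ D ∧ [] ∈ X} = _
    rw [this]
  choose g hg using check_succ hD hinf
  let F : ℕ → checkSet D := fun n =>
    Nat.rec ⟨[], h0⟩ (fun _ p => ⟨p.1 ++ [g p.1 p.2], hg p.1 p.2⟩) n
  let f : ℕ → List Bool := fun n => (F n).1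
  have hfs : ∀ n, f (n + 1) = f n ++ [g (f n) (F n).2] := fun n => rfl
  have hlen : ∀ n, (f n).length = n := by
    intro n
    induction n with
    | zero => rfl
    | succ k ih => rw [hfs]; simp [ih]
  have hmono : ∀ m n, m ≤ n → f m <+: f n := by
    intro m n h
    induction h with
    | refl => exact List.prefix_refl _
    | step _ ih => exact ih.trans (by rw [Nat.succ_eq_add_one, hfs]; exact List.prefix_append _ _)
  have hsub : Set.range f ⊆ checkSet D := by
    rintro _ ⟨n, rfl⟩; exact (F n).2
  have hbr : Set.range f ∈ Branches := by
    constructor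
    · rintro _ ⟨m, rfl⟩ _ ⟨n, rfl⟩ _
      rcases le_total m n with h | h
      · exact Or.inl (hmono _ _ h)
      · exact Or.inr (hmono _ _ h)
    · intro t ht hst
      refine Set.Subset.antisymm hst fun x hx => ⟨x.length, ?_⟩
      by_contra hne
      rcases ht (hst ⟨x.length, rfl⟩) hx hne with h | h
      · exact hne (h.eq_of_length (hlen _))
      · exact hne (h.eq_of_length (hlen _).symm).symm
  refine ⟨⟨_, hbr, hsub⟩, ?_, ?_⟩
  · refine (Set.infinite_range_of_injective fun m n h => ?_).mono hsub
    rw [← hlen m, h, hlen]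
  · intro hreg hunc hch
    have heq : Set.range f = checkSet D := hbr.2 hch hsub
    have hcov : D ⊆ {Set.range f} ∪
        ⋃ s : ↥(checkSet D)ᶜ, {X : Set (List Bool) | X ∈ D ∧ s.1 ∈ X} := by
      intro X hX
      by_cases hXs : X ⊆ Set.range f
      · left; exact (hD hX).2 hbr.1 hXs
      · right
        obtain ⟨s, hs, hns⟩ := Set.not_subset.mp hXs
        rw [heq] at hns
        exact Set.mem_iUnion.mpr ⟨⟨s, hns⟩, hX, hs⟩
    have hU : Cardinal.mk ↥(⋃ s : ↥(checkSet D)ᶜ, {X : Set (List Bool) | X ∈ D ∧ s.1 ∈ X})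
        < Cardinal.mk ↥D := by
      refine (Cardinal.card_iUnion_lt_iff_forall_of_isRegular hreg
        (Cardinal.mk_le_aleph0.trans_lt hunc)).mpr fun s => ?_
      exact lt_of_le_of_ne (Cardinal.mk_le_mk_of_subset fun X hX => hX.1) s.2
    have h1 : Cardinal.mk ↥({Set.range f} : Set (Set (List Bool))) < Cardinal.mk ↥D := by
      rw [Cardinal.mk_singleton]; exact Cardinal.one_lt_aleph0.trans hunc
    exact absurd (((Cardinal.mk_le_mk_of_subset hcov).trans (Cardinal.mk_union_le _ _)).trans_lt
      (Cardinal.add_lt_of_lt hunc.le h1 hU)) (lt_irrefl _)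
end

section
/- Fix r ∈ S and let A := { ↓x : x ∈ S and x ≤_ℝ r }. Then (A, ∅) is a minimal gap of L(S,≤) of cardinality (ℵ₁, 0); that is, A has cardinality ℵ₁, A has no upper bound in L(S,≤), and every subset of A of cardinality less than ℵ₁ has an upper bound in L(S,≤). -/
universe u

lemma aux_seg_countable (S : Set ℝ) (w : S → S → Prop) [IsWellOrder S w]
    (h : Ordinal.type w = (Cardinal.aleph 1).ord) (x : S) : {y : S | leW w y x}.Countable := by
  have h1 : {y : S | w y x}.Countable := by
    rw [Cardinal.countable_iff_lt_aleph_one]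
    have := Ordinal.typein_lt_type w x
    rw [h, Cardinal.lt_ord] at this
    exact this
  refine (h1.union (Set.countable_singleton x)).mono ?_
  rintro y (hy | hy)
  · exact Or.inl hy
  · exact Or.inr hy

lemma aux_dseg_Lmem (S : Set ℝ) (w : S → S → Prop) (x : S) : Lmem w (dseg w x) :=
  ⟨{{x}}, by simp, by simp, by
    ext y
    simp only [Finset.mem_singleton, Set.iUnion_iUnion_eq_left, Set.mem_iInter]
    exact ⟨fun hy i hi => hi ▸ hy, fun hy => hy x rfl⟩⟩

lemma aux_self (S : Set ℝ) (w : S → S → Prop) (x : S) : x ∈ dseg w x :=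
  ⟨Or.inr rfl, le_refl _⟩

theorem minimal_gap_A_empty (S : Set ℝ) (w : S → S → Prop) [IsWellOrder S w]
    (h : SierpCond S w) (r : S) (A : Set (LS S w))
    (hAdef : A = {a : LS S w | ∃ x : S, (x : ℝ) ≤ (r : ℝ) ∧ (a : Set S) = dseg w x}) :
    Cardinal.mk ↥A = Cardinal.aleph 1 ∧
    (¬ ∃ u : LS S w, ∀ a ∈ A, a ≤ u) ∧
    ∀ A' ⊆ A, Cardinal.mk ↥A' < Cardinal.aleph 1 → ∃ u : LS S w, ∀ a ∈ A', a ≤ u := by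
  obtain ⟨hS, hdense, htop, hbot, htype⟩ := h
  subst hAdef
  obtain ⟨b, hb⟩ := hbot r
  have hbig : Cardinal.aleph 1 ≤ Cardinal.mk ↥{x : S | (x : ℝ) ≤ (r : ℝ)} :=
    (hdense b r hb).trans (Cardinal.mk_le_mk_of_subset fun x hx => hx.2.le)
  refine ⟨?_, ?_, ?_⟩
  · apply le_antisymm
    · rw [← hS]
      refine Cardinal.mk_le_of_injective (f := fun a => a.2.choose) ?_
      intro a a' haa
      have h1 := a.2.choose_spec.2
      have h2 := a'.2.choose_spec.2
      apply Subtype.ext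
      apply Subtype.ext
      rw [h1, h2]
      exact congrArg _ haa
    · refine hbig.trans ?_
      refine Cardinal.mk_le_of_injective
        (f := fun x => ⟨⟨dseg w x.1, aux_dseg_Lmem S w x.1⟩, x.1, x.2, rfl⟩) ?_
      intro x y hxy
      have e : dseg w x.1 = dseg w y.1 := congrArg (fun a => a.1.1) hxy
      have h1 : x.1 ∈ dseg w y.1 := e ▸ aux_self S w x.1
      have h2 : y.1 ∈ dseg w x.1 := e.symm ▸ aux_self S w y.1
      exact Subtype.ext (Subtype.ext (le_antisymm h1.2 h2.2))
  · rintro ⟨⟨u, F, hF, hG, hu⟩, hub⟩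
    have hc : u.Countable := by
      rw [hu]
      refine F.countable_toSet.biUnion fun G hGF => ?_
      obtain ⟨x, hx⟩ := hG G hGF
      refine (aux_seg_countable S w htype x).mono ?_
      intro y hy
      exact (Set.mem_iInter₂.1 hy x hx).1
    have hsub : {x : S | (x : ℝ) ≤ (r : ℝ)} ⊆ u := fun x hx =>
      hub ⟨dseg w x, aux_dseg_Lmem S w x⟩ ⟨x, hx, rfl⟩ (aux_self S w x)
    have := hc.mono hsub
    rw [Cardinal.countable_iff_lt_aleph_one] at this
    exact absurd this (not_lt.2 hbig)
  · intro A' hA' hcard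
    have hA'c : A'.Countable := (Cardinal.countable_iff_lt_aleph_one _).2 hcard
    have : Nonempty S := ⟨r⟩
    have hA2 : ∀ a : LS S w, a ∈ A' → ∃ x : S, (x : ℝ) ≤ (r : ℝ) ∧ (a : Set S) = dseg w x :=
      fun a ha => hA' ha
    choose! f hf using hA2
    obtain ⟨t, ht⟩ := htop r
    have hbad : (⋃ a ∈ A', {y : S | leW w y (f a)}).Countable :=
      hA'c.biUnion fun a _ => aux_seg_countable S w htype (f a)
    have hex : ∃ c : S, (r : ℝ) < c ∧ c ∉ ⋃ a ∈ A', {y : S | leW w y (f a)} := by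
      by_contra hcon
      push Not at hcon
      have hh := hbad.mono (s₁ := {x : S | (r : ℝ) < (x : ℝ) ∧ (x : ℝ) < (t : ℝ)})
        fun x hx => hcon x hx.1
      rw [Cardinal.countable_iff_lt_aleph_one] at hh
      exact absurd hh (not_lt.2 (hdense r t ht))
    obtain ⟨c, hrc, hc⟩ := hex
    refine ⟨⟨dseg w c, aux_dseg_Lmem S w c⟩, ?_⟩
    intro a ha y hy
    have hfa := hf a ha
    have hnot : ¬ leW w c (f a) := fun hcc => hc (Set.mem_iUnion₂.2 ⟨a, ha, hcc⟩)
    have hw : w (f a) c := by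
      rcases trichotomous_of w (f a) c with h1 | h1 | h1
      · exact h1
      · exact absurd (Or.inr h1.symm) hnot
      · exact absurd (Or.inl h1) hnot
    have hy' : y ∈ dseg w (f a) := hfa.2 ▸ hy
    refine ⟨Or.inl ?_, hy'.2.trans (hfa.1.trans hrc.le)⟩
    rcases hy'.1 with h1 | h1
    · exact _root_.trans h1 hw
    · exact h1 ▸ hw
end

section
/- The poset (S, ≤) is up-directed: for all x, y ∈ S there exists z ∈ S with x ≤ z and y ≤ z. -/
universe u

theorem sierp_up_directed (S : Set ℝ) (w : S → S → Prop) [IsWellOrder S w]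
    (h : SierpCond S w) :
    ∀ x y : S, ∃ z : S, poS w x z ∧ poS w y z := by
  obtain ⟨-, hd, hmax, -, ht⟩ := h
  -- every initial segment of `w` has cardinality less than `ℵ₁`
  have hseg : ∀ m : S, {z : S | ¬ w m z}.Countable := by
    intro m
    have h1 : Cardinal.mk {z : S | w z m} < Cardinal.aleph 1 := by
      have h2 : Ordinal.typein w m < (Cardinal.aleph 1).ord := ht ▸ Ordinal.typein_lt_type w m
      rw [Cardinal.lt_ord] at h2
      exact h2
    have h3 : {z : S | w z m}.Countable := by
      rw [← Set.countable_coe_iff, ← Cardinal.mk_le_aleph0_iff]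
      rw [← Cardinal.succ_aleph0] at h1
      exact Order.lt_succ_iff.mp h1
    refine (h3.insert m).mono ?_
    intro z hz
    rcases trichotomous_of w z m with h | h | h
    · exact Or.inr h
    · exact Or.inl h
    · exact absurd h hz
  intro x y
  obtain ⟨M, hxM, hyM⟩ : ∃ M : S, (x : ℝ) ≤ M ∧ (y : ℝ) ≤ M := by
    rcases le_total (x : ℝ) y with h | h
    · exact ⟨y, h, le_rfl⟩
    · exact ⟨x, le_rfl, h⟩
  obtain ⟨b, hb⟩ := hmax M
  have hbig := hd M b hb
  have hc := (hseg x).union (hseg y)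
  have hex : ¬ ({z : S | (M : ℝ) < z ∧ (z : ℝ) < b} ⊆ {z : S | ¬ w x z} ∪ {z : S | ¬ w y z}) := by
    intro hsub
    have h4 := hc.mono hsub
    rw [← Set.countable_coe_iff, ← Cardinal.mk_le_aleph0_iff] at h4
    exact absurd (hbig.trans h4) (not_le.mpr Cardinal.aleph0_lt_aleph_one)
  obtain ⟨z, ⟨hz, -⟩, hn⟩ := Set.not_subset.mp hex
  simp only [Set.mem_union, Set.mem_setOf_eq, not_or, not_not] at hn
  exact ⟨z, ⟨Or.inl hn.1, hxM.trans hz.le⟩, ⟨Or.inl hn.2, hyM.trans hz.le⟩⟩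
end

section
/- A subset B of L(S,≤) has an upper bound in L(S,≤) if and only if ⋃B has an upper bound in (S,≤), i.e., there exists z ∈ S with y ≤ z for every y ∈ ⋃B. -/
universe u

theorem exists_above (S : Set ℝ) (w : S → S → Prop) [IsWellOrder S w]
    (h : SierpCond S w) (t a : S) : ∃ x : S, w t x ∧ (a : ℝ) < x := by
  obtain ⟨-, hd, hu, -, ho⟩ := h
  obtain ⟨c, hc⟩ := hu a
  by_contra! hcon
  have h1 : Cardinal.mk ↥{y : S | w y t} < Cardinal.aleph 1 := by
    have h2 := Ordinal.typein_lt_type w t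
    rw [ho, Cardinal.lt_ord] at h2
    exact h2
  have h3 : {x : S | (a : ℝ) < (x : ℝ) ∧ (x : ℝ) < (c : ℝ)} ⊆ insert t {y : S | w y t} := by
    rintro x ⟨hx, -⟩
    rcases trichotomous_of w t x with h4 | h4 | h4
    · exact absurd hx (not_lt.2 (hcon x h4))
    · exact Or.inl h4.symm
    · exact Or.inr h4
  have h5 := ((hd a c hc).trans (Cardinal.mk_le_mk_of_subset h3)).trans Cardinal.mk_insert_le
  exact absurd h5 (not_le.2 (Cardinal.add_lt_of_lt (Cardinal.aleph0_le_aleph 1) h1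
    (Cardinal.one_lt_aleph0.trans_le (Cardinal.aleph0_le_aleph 1))))

theorem poS_trans_s14 {S : Set ℝ} (w : S → S → Prop) [IsWellOrder S w] {x y z : S}
    (h1 : poS w x y) (h2 : poS w y z) : poS w x z := by
  refine ⟨?_, h1.2.trans h2.2⟩
  rcases h1.1 with h | rfl
  · rcases h2.1 with h' | rfl
    · exact Or.inl (_root_.trans h h')
    · exact Or.inl h
  · exact h2.1

theorem poS_directed (S : Set ℝ) (w : S → S → Prop) [IsWellOrder S w]
    (h : SierpCond S w) (a b : S) : ∃ z : S, poS w a z ∧ poS w b z := by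
  obtain ⟨m, hma, hmb⟩ : ∃ m : S, (a : ℝ) ≤ m ∧ (b : ℝ) ≤ m := by
    rcases le_total (a : ℝ) b with h1 | h1
    · exact ⟨b, h1, le_rfl⟩
    · exact ⟨a, le_rfl, h1⟩
  obtain ⟨t, hta, htb⟩ : ∃ t : S, leW w a t ∧ leW w b t := by
    rcases trichotomous_of w a b with h1 | h1 | h1
    · exact ⟨b, Or.inl h1, Or.inr rfl⟩
    · exact ⟨b, Or.inr h1, Or.inr rfl⟩
    · exact ⟨a, Or.inr rfl, Or.inl h1⟩
  obtain ⟨z, hz, hmz⟩ := exists_above S w h t m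
  have key : ∀ c, leW w c t → leW w c z := by
    rintro c (hc | rfl)
    · exact Or.inl (_root_.trans hc hz)
    · exact Or.inl hz
  exact ⟨z, ⟨key a hta, hma.trans hmz.le⟩, ⟨key b htb, hmb.trans hmz.le⟩⟩

theorem bounded_iff_union_bounded (S : Set ℝ) (w : S → S → Prop) [IsWellOrder S w]
    (h : SierpCond S w) (B : Set (LS S w)) :
    (∃ u : LS S w, ∀ X ∈ B, X ≤ u) ↔
      ∃ z : S, ∀ y : S, (∃ X ∈ B, y ∈ (X : Set S)) → poS w y z := by
  classical
  constructor
  · rintro ⟨⟨U, F, hF, hG, rfl⟩, hu⟩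
    have key : ∀ F : Finset (Finset S), (∀ G ∈ F, G.Nonempty) → F.Nonempty →
        ∃ z : S, ∀ G ∈ F, ∀ y ∈ ⋂ x ∈ G, dseg w x, poS w y z := by
      intro F hG hF
      induction hF using Finset.Nonempty.cons_induction with
      | singleton G =>
        obtain ⟨g, hg⟩ := hG G (by simp)
        refine ⟨g, fun G' hG' y hy => ?_⟩
        obtain rfl := Finset.mem_singleton.1 hG'
        exact Set.mem_iInter₂.1 hy g hg
      | cons G F hn hF ih =>
        obtain ⟨z, hz⟩ := ih (fun G' hG' => hG G' (Finset.mem_cons_of_mem hG'))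
        obtain ⟨g, hg⟩ := hG G (Finset.mem_cons_self _ _)
        obtain ⟨v, hgv, hzv⟩ := poS_directed S w h g z
        refine ⟨v, fun G' hG' y hy => ?_⟩
        rcases Finset.mem_cons.1 hG' with rfl | h'
        · exact poS_trans_s14 w (Set.mem_iInter₂.1 hy g hg) hgv
        · exact poS_trans_s14 w (hz G' h' y hy) hzv
    obtain ⟨z, hz⟩ := key F hG hF
    refine ⟨z, ?_⟩
    rintro y ⟨X, hX, hy⟩
    have hyu := hu X hX hy
    obtain ⟨G, hGF, hyG⟩ := Set.mem_iUnion₂.1 hyu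
    exact hz G hGF y hyG
  · rintro ⟨z, hz⟩
    refine ⟨⟨dseg w z, {{z}}, by simp, by simp,
      by rw [Finset.set_biUnion_singleton, Finset.set_biInter_singleton]⟩, ?_⟩
    intro X hX y hy
    exact hz y ⟨X, hX, hy⟩
end

section
/- Let L be a distributive lattice and (A,B) a gap of L. Then L can be partitioned into a prime ideal I and a prime filter F such that A ⊆ I and (A,∅) is a gap of I (A has no upper bound in I), and B ⊆ F and (∅,B) is a gap of F (B has no lower bound in F). -/
universe u

theorem distrib_lattice_gap_partition (L : Type u) [DistribLattice L] (A B : Set L)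
    (hgap : IsGap A B) :
    ∃ I F : Set L, I ∪ F = Set.univ ∧ Disjoint I F ∧
      IsLowerSet I ∧ (∀ a ∈ I, ∀ b ∈ I, a ⊔ b ∈ I) ∧
      IsUpperSet F ∧ (∀ a ∈ F, ∀ b ∈ F, a ⊓ b ∈ F) ∧
      A ⊆ I ∧ (¬ ∃ u ∈ I, ∀ a ∈ A, a ≤ u) ∧
      B ⊆ F ∧ ¬ ∃ l ∈ F, ∀ b ∈ B, l ≤ b := by
  obtain ⟨hpre, hno⟩ := hgap
  by_cases hJ : (lowerBounds B).Nonempty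
  swap
  · have hA : ∀ a, a ∉ A := fun a ha => hJ ⟨a, fun b hb => hpre a ha b hb⟩
    refine ⟨∅, Set.univ, by simp, by simp, fun _ _ _ h => h, by simp, fun _ _ _ h => h, by simp,
      fun a ha => hA a ha, by simp, by simp, ?_⟩
    rintro ⟨l, -, hl⟩
    exact hJ ⟨l, fun b hb => hl b hb⟩
  by_cases hG : (upperBounds A).Nonempty
  swap
  · have hB : ∀ b, b ∉ B := fun b hb => hG ⟨b, fun a ha => hpre a ha b hb⟩
    refine ⟨Set.univ, ∅, by simp, by simp, fun _ _ _ h => h, by simp, fun _ _ _ h => h, by simp,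
      by simp, ?_, fun b hb => hB b hb, by simp⟩
    rintro ⟨l, -, hl⟩
    exact hG ⟨l, fun b hb => hl b hb⟩
  let J : Order.Ideal L :=
    { carrier := lowerBounds B
      lower' := fun x y hyx hx b hb => hyx.trans (hx hb)
      nonempty' := hJ
      directed' := fun x hx y hy =>
        ⟨x ⊔ y, fun b hb => sup_le (hx hb) (hy hb), le_sup_left, le_sup_right⟩ }
  have hF : Order.IsPFilter (upperBounds A) := Order.IsPFilter.of_def hG
    (fun x hx y hy => ⟨x ⊓ y, fun a ha => le_inf (hx ha) (hy ha), inf_le_left, inf_le_right⟩)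
    (fun {x y} hxy hx a ha => (hx ha).trans hxy)
  have hdis : Disjoint (hF.toPFilter : Set L) (J : Set L) := by
    rw [Set.disjoint_left]
    intro x hx hx'
    exact hno ⟨x, fun a ha => hx ha, fun b hb => hx' hb⟩
  obtain ⟨I, hI, hJI, hFI⟩ := DistribLattice.prime_ideal_of_disjoint_filter_ideal hdis
  rw [Set.disjoint_left] at hFI
  refine ⟨I, (I : Set L)ᶜ, by simp, disjoint_compl_right, I.lower,
    fun a ha b hb => Order.Ideal.sup_mem ha hb, I.lower.compl, ?_, ?_, ?_, ?_, ?_⟩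
  · intro a ha b hb hab
    exact (hI.mem_or_mem hab).elim ha hb
  · intro a ha
    exact hJI (show a ∈ lowerBounds B from fun b hb => hpre a ha b hb)
  · rintro ⟨u, hu, h⟩
    exact hFI (show u ∈ upperBounds A from fun a ha => h a ha) hu
  · intro b hb
    exact hFI (show b ∈ upperBounds A from fun a ha => hpre a ha b hb)
  · rintro ⟨l, hl, h⟩
    exact hl (hJI (show l ∈ lowerBounds B from fun b hb => h b hb))
end

section
/- Every prime filter F of the lattice L(S,≤) has countable coinitiality: there is a countable subset U of F such that every element of F lies above some element of U. -/
universe u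

theorem aux_interLmem {S : Set ℝ} (w : S → S → Prop) (G : Finset S) (hG : G.Nonempty) :
    Lmem w (⋂ x ∈ G, dseg w x) :=
  ⟨{G}, by simp, by simpa using hG, by simp⟩

theorem aux_dsegLmem {S : Set ℝ} (w : S → S → Prop) (x : S) : Lmem w (dseg w x) := by
  have := aux_interLmem w {x} (by simp)
  simpa using this

theorem aux_prime {S : Set ℝ} {w : S → S → Prop} (F : Set (LS S w))
    (hprime : ∀ X Y Z : LS S w, (Z : Set S) = (X : Set S) ∪ (Y : Set S) → Z ∈ F → X ∈ F ∨ Y ∈ F)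
    (A : Finset (Finset S)) (hA : A.Nonempty) :
    (∀ G ∈ A, G.Nonempty) → ∀ Z ∈ F, (Z : Set S) = ⋃ G ∈ A, ⋂ x ∈ G, dseg w x →
      ∃ G ∈ A, ∃ Y ∈ F, (Y : Set S) = ⋂ x ∈ G, dseg w x := by
  induction hA using Finset.Nonempty.cons_induction with
  | singleton G =>
    intro _ Z hZ hZe
    exact ⟨G, by simp, Z, hZ, by simpa using hZe⟩
  | cons G A hGA hA ih =>
    intro hne Z hZ hZe
    have hne' : ∀ H ∈ A, H.Nonempty := fun H hH => hne H (by simp [hH])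
    rcases hprime ⟨_, aux_interLmem w G (hne G (by simp))⟩
      ⟨⋃ G ∈ A, ⋂ x ∈ G, dseg w x, A, hA, hne', rfl⟩ Z (by rw [hZe]; simp) hZ with h1 | h1
    · exact ⟨G, by simp, _, h1, rfl⟩
    · obtain ⟨H, hH, Y, hY, e⟩ := ih hne' _ h1 rfl
      exact ⟨H, by simp [hH], Y, hY, e⟩

theorem aux_coinitial {S : Set ℝ} (T : Set S) :
    ∃ T' : Set S, T'.Countable ∧ T' ⊆ T ∧ ∀ x ∈ T, ∃ t ∈ T', t ≤ x := by
  classical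
  by_cases hm : ∃ m ∈ T, ∀ x ∈ T, m ≤ x
  · obtain ⟨m, hm, hmin⟩ := hm
    exact ⟨{m}, by simp, by simpa using hm, fun x hx => ⟨m, rfl, hmin x hx⟩⟩
  · push Not at hm
    let P : ℚ → Prop := fun q => ∃ t ∈ T, (t : ℝ) < q
    let f : {q : ℚ // P q} → S := fun q => Classical.choose q.2
    have hf : ∀ q, f q ∈ T ∧ (f q : ℝ) < (q.1 : ℝ) := fun q => Classical.choose_spec q.2
    refine ⟨Set.range f, Set.countable_range f, ?_, ?_⟩
    · rintro _ ⟨q, rfl⟩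
      exact (hf q).1
    · intro x hx
      obtain ⟨s, hs, hsx⟩ := hm x hx
      obtain ⟨q, h1, h2⟩ := exists_rat_btwn (show (s : ℝ) < x from hsx)
      exact ⟨f ⟨q, s, hs, h1⟩, ⟨_, rfl⟩, ((hf ⟨q, s, hs, h1⟩).2.trans h2).le⟩

theorem prime_filter_countably_coinitial (S : Set ℝ) (w : S → S → Prop) [IsWellOrder S w]
    (h : SierpCond S w) (F : Set (LS S w))
    (hup : IsUpperSet F)
    (hmeet : ∀ X ∈ F, ∀ Y ∈ F, ∀ Z : LS S w, (Z : Set S) = (X : Set S) ∩ (Y : Set S) → Z ∈ F)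
    (hprime : ∀ X Y Z : LS S w, (Z : Set S) = (X : Set S) ∪ (Y : Set S) → Z ∈ F → X ∈ F ∨ Y ∈ F) :
    ∃ U : Set (LS S w), U.Countable ∧ U ⊆ F ∧ ∀ X ∈ F, ∃ u ∈ U, u ≤ X := by
  classical
  let d : S → LS S w := fun x => ⟨dseg w x, aux_dsegLmem w x⟩
  let T : Set S := {x | d x ∈ F}
  have key : ∀ X ∈ F, ∃ G : Finset S, G.Nonempty ∧ (∀ x ∈ G, x ∈ T) ∧
      (⋂ x ∈ G, dseg w x) ⊆ (X : Set S) := by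
    intro X hX
    obtain ⟨A, hA, hne, e⟩ := X.2
    obtain ⟨G, hG, Y, hY, hYe⟩ := aux_prime F hprime A hA hne X hX e
    refine ⟨G, hne G hG, fun x hx => hup (a := Y) ?_ hY, ?_⟩
    · change (Y : Set S) ⊆ dseg w x
      rw [hYe]
      exact Set.biInter_subset_of_mem hx
    · rw [e]
      exact Set.subset_biUnion_of_mem (u := fun G : Finset S => ⋂ x ∈ G, dseg w x) hG
  by_cases hT : T.Nonempty
  · have wf : WellFounded w := IsWellFounded.wf
    obtain ⟨m, hmT, hmin⟩ := wf.has_min T hT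
    have hmin' : ∀ x ∈ T, w m x ∨ m = x := by
      intro x hx
      rcases trichotomous_of w m x with h1 | h1 | h1
      · exact .inl h1
      · exact .inr h1
      · exact absurd h1 (hmin x hx)
    obtain ⟨T', hc, hsub, hco⟩ := aux_coinitial T
    let g : S → LS S w := fun t =>
      ⟨⋂ x ∈ ({m, t} : Finset S), dseg w x, aux_interLmem w _ (by simp)⟩
    have hg : ∀ t, (g t : Set S) = dseg w m ∩ dseg w t := by
      intro t; simp [g]
    refine ⟨g '' T', hc.image g, ?_, ?_⟩
    · rintro _ ⟨t, ht, rfl⟩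
      exact hmeet _ hmT _ (hsub ht) _ (hg t)
    · intro X hX
      obtain ⟨G, hGne, hGT, hGX⟩ := key X hX
      obtain ⟨r, hr, hrmin⟩ := G.exists_min_image id hGne
      obtain ⟨t, ht, htr⟩ := hco r (hGT r hr)
      refine ⟨g t, ⟨t, ht, rfl⟩, ?_⟩
      change (g t : Set S) ⊆ X
      rw [hg]
      refine subset_trans ?_ hGX
      rintro y ⟨⟨hy1, _⟩, ⟨_, hy2⟩⟩
      simp only [Set.mem_iInter]
      intro x hx
      refine ⟨?_, hy2.trans (show (t : ℝ) ≤ x from htr.trans (hrmin x hx))⟩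
      rcases hmin' x (hGT x hx) with h2 | rfl
      · rcases hy1 with h1 | rfl
        · exact .inl (_root_.trans h1 h2)
        · exact .inl h2
      · exact hy1
  · refine ⟨∅, by simp, by simp, fun X hX => ?_⟩
    obtain ⟨G, ⟨x, hx⟩, hGT, _⟩ := key X hX
    exact absurd ⟨x, hGT x hx⟩ hT
end

section
/- In any poset P, every gap has a subgap which is minimal. -/
universe u

/-- A gap is minimal if every subgap has the same cardinality as the gap itself. -/
def MinimalGap {P : Type u} [Preorder P] (A B : Set P) : Prop :=
  IsGap A B ∧ ∀ A' ⊆ A, ∀ B' ⊆ B, IsGap A' B' →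
    Cardinal.mk ↥A' = Cardinal.mk ↥A ∧ Cardinal.mk ↥B' = Cardinal.mk ↥B

theorem gap_has_minimal_subgap (P : Type u) [PartialOrder P] (A B : Set P)
    (h : IsGap A B) :
    ∃ A' B' : Set P, A' ⊆ A ∧ B' ⊆ B ∧ MinimalGap A' B' := by
  let S : Set (Cardinal.{u} × Cardinal.{u}) :=
    {p | ∃ A' B' : Set P, A' ⊆ A ∧ B' ⊆ B ∧ IsGap A' B' ∧
      p = (Cardinal.mk ↥A', Cardinal.mk ↥B')}
  have hS : S.Nonempty := ⟨_, A, B, subset_rfl, subset_rfl, h, rfl⟩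
  obtain ⟨p, ⟨A', B', hA, hB, hg, rfl⟩, hmin⟩ :=
    (wellFounded_lt (α := Cardinal.{u} × Cardinal.{u})).has_min S hS
  refine ⟨A', B', hA, hB, hg, fun A'' hA'' B'' hB'' hg'' => ?_⟩
  have hn := hmin _ ⟨A'', B'', hA''.trans hA, hB''.trans hB, hg'', rfl⟩
  have hle : (Cardinal.mk ↥A'', Cardinal.mk ↥B'') ≤ (Cardinal.mk ↥A', Cardinal.mk ↥B') :=
    ⟨Cardinal.mk_le_mk_of_subset hA'', Cardinal.mk_le_mk_of_subset hB''⟩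
  exact Prod.mk.inj (eq_of_le_of_not_lt hle hn)
end
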